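/- arXiv:1308.2405 — 3 statements merged into one kernel-verified Lean document; each statement's English description precedes it below -/
import Mathlib

section
/- Let m > n ≥ 1 be integers, let 0 < ε < 1/3, let c ∈ ℝ^m, and let q1, q2 > 0. Suppose X ∈ ℤ^{n×m} has quality (q1, q2) and R ∈ ℝ^{m×m} is invertible with least singular value σ_m(R) ≥ (1 + q1·q2) · √(ln(2(m−n)(1 + 1/ε))/π). Then the statistical distance between E_{X,R,c} and the discrete Gaussian D_{ℤ^n + Xc, RXᵀ} is at most 2ε. (Quality of X implies Xℤ^m = ℤ^n, so both distributions are supported on ℤ^n + Xc.) -/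
open scoped BigOperators Matrix
attribute [local instance] Classical.propDecidable

/-- Ellipsoidal Gaussian function `ρ_S(x) = exp(-π xᵀ (SᵀS)⁻¹ x)` for a (rank-`n`)
matrix `S ∈ ℝ^{m×n}` and `x ∈ ℝ^n`. -/
noncomputable def rho {m n : ℕ} (S : Matrix (Fin m) (Fin n) ℝ) (x : Fin n → ℝ) : ℝ :=
  Real.exp (-Real.pi * (x ⬝ᵥ ((Sᵀ * S)⁻¹ *ᵥ x)))

/-- Coordinatewise cast of an integer vector to a real vector. -/
def intCast' {k : ℕ} (v : Fin k → ℤ) : Fin k → ℝ := fun i => (v i : ℝ)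

/-- Euclidean (ℓ2) norm of a real vector. -/
noncomputable def enorm' {k : ℕ} (x : Fin k → ℝ) : ℝ := Real.sqrt (∑ i, (x i) ^ 2)

/-- `X ∈ ℤ^{n×m}` has quality `(q1, q2)`: every column has ℓ2-norm at most `q1`, and
there are pairwise orthogonal `u_1, …, u_n ∈ ℤ^m` with `u_i ⬝ x_j = δ_{ij}` (where
`x_j` are the rows of `X`) and `‖u_i‖₂ ≤ q2`. -/
def HasQuality {n m : ℕ} (X : Matrix (Fin n) (Fin m) ℤ) (q1 q2 : ℝ) : Prop :=
  (∀ j : Fin m, Real.sqrt (∑ i, ((X i j : ℝ)) ^ 2) ≤ q1) ∧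
  ∃ u : Fin n → Fin m → ℤ,
    (∀ i i', i ≠ i' → ∑ j, u i j * u i' j = 0) ∧
    (∀ i i', ∑ j, u i j * X i' j = if i = i' then 1 else 0) ∧
    (∀ i, Real.sqrt (∑ j, ((u i j : ℝ)) ^ 2) ≤ q2)

/-- The probability that `E_{X,R,c}` (the distribution of `X·v` for `v ← D_{ℤ^m + c, R}`)
assigns to the point `z ∈ ℝ^n`. -/
noncomputable def Edist {n m : ℕ} (X : Matrix (Fin n) (Fin m) ℝ)
    (R : Matrix (Fin m) (Fin m) ℝ) (c : Fin m → ℝ) (z : Fin n → ℝ) : ℝ :=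
  (∑' v : Fin m → ℤ, if X *ᵥ (intCast' v + c) = z then rho R (intCast' v + c) else 0) /
  (∑' v : Fin m → ℤ, rho R (intCast' v + c))

/-- A shifted Gaussian is summable over the integers. -/
theorem summable_exp_neg_mul_sq_int_add {d : ℝ} (hd : 0 < d) (s : ℝ) :
    Summable fun j : ℤ => Real.exp (-Real.pi * (d * ((j : ℝ) + s) ^ 2)) := by
  have h := ((summable_jacobiTheta₂_term_iff (Complex.I * (s * d : ℝ))
    (Complex.I * (d : ℝ))).2 (by simpa using hd)).norm
  refine (h.mul_right (Real.exp (-Real.pi * (d * s ^ 2)))).congr fun j => ?_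
  rw [norm_jacobiTheta₂_term, ← Real.exp_add]
  congr 1
  simp
  ring

theorem hasSum_pow_natAbs_of_ne_zero {q : ℝ} (h0 : 0 ≤ q) (h1 : q < 1) :
    HasSum (fun n : ℤ => if n = 0 then 0 else q ^ n.natAbs) (2 * q / (1 - q)) := by
  have hg : HasSum (fun n : ℕ => q ^ (n + 1)) (q / (1 - q)) := by
    simpa [pow_succ, div_eq_mul_inv, mul_comm] using (hasSum_geometric_of_lt_one h0 h1).mul_right q
  have hs : (2 * q / (1 - q)) = q / (1 - q) + q / (1 - q) := by ring
  rw [hs]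
  refine HasSum.of_nat_of_neg_add_one ?_ ?_
  · refine (hasSum_nat_add_iff' 1).1 ?_
    simp only [Finset.range_one, Finset.sum_singleton, Nat.cast_zero, if_true, sub_zero]
    refine hg.congr_fun fun n => ?_
    have : ((n + 1 : ℕ) : ℤ) ≠ 0 := by omega
    rw [if_neg this, Int.natAbs_natCast]
  · refine hg.congr_fun fun n => ?_
    have : -((n : ℤ) + 1) ≠ 0 := by omega
    rw [if_neg this]
    congr 1

/-- By Poisson summation, a suitably normalised Gaussian sum over a shift of `ℤ` is close to `1`. -/
theorem exists_abs_mul_tsum_gaussian_sub_one_le {d : ℝ} (hd : 0 < d) :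
    ∃ K : ℝ, 0 < K ∧ ∀ s : ℝ,
      |K * ∑' j : ℤ, Real.exp (-Real.pi * (d * ((j : ℝ) + s) ^ 2)) - 1| ≤
        2 * Real.exp (-Real.pi / d) / (1 - Real.exp (-Real.pi / d)) := by
  set q := Real.exp (-Real.pi / d) with hq
  have hq0 : 0 ≤ q := (Real.exp_pos _).le
  have hq1 : q < 1 := Real.exp_lt_one_iff.2 (div_neg_of_neg_of_pos (neg_lt_zero.2 Real.pi_pos) hd)
  have hdi : 0 < 1 / d := by positivity
  refine ⟨1 / (1 / d) ^ (1 / 2 : ℝ), by positivity, fun s => ?_⟩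
  have hP := Complex.tsum_exp_neg_quadratic (a := ((1 / d : ℝ) : ℂ))
    (by simpa using hd) (-Complex.I * s)
  have hR : ∀ n : ℤ, Complex.exp (-Real.pi / ((1 / d : ℝ) : ℂ) *
      (n + Complex.I * (-Complex.I * s)) ^ 2) =
      ((Real.exp (-Real.pi * (d * ((n : ℝ) + s) ^ 2)) : ℝ) : ℂ) := by
    intro n
    have : Complex.I * (-Complex.I * s) = s := by
      rw [← mul_assoc, mul_neg, Complex.I_mul_I]; simp
    rw [this]
    push_cast
    congr 1
    field_simp
  simp_rw [hR] at hP
  rw [← Complex.ofReal_tsum] at hP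
  have hK : (1 / ((1 / d : ℝ) : ℂ) ^ (1 / 2 : ℂ)) = ((1 / (1 / d) ^ (1 / 2 : ℝ) : ℝ) : ℂ) := by
    rw [Complex.ofReal_div 1 ((1 / d) ^ (1 / 2 : ℝ)), Complex.ofReal_cpow hdi.le]
    simp
  rw [hK, ← Complex.ofReal_mul] at hP
  set g : ℤ → ℂ := fun n => Complex.exp (-Real.pi * ((1 / d : ℝ) : ℂ) * n ^ 2 +
    2 * Real.pi * (-Complex.I * s) * n) with hg
  have hb := hasSum_pow_natAbs_of_ne_zero hq0 hq1
  have hle : ∀ n : ℤ, ‖g n - if n = 0 then 1 else 0‖ ≤ if n = 0 then 0 else q ^ n.natAbs := by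
    intro n
    by_cases hn : n = 0
    · simp [hg, hn]
    · rw [if_neg hn, if_neg hn, sub_zero, hg, Complex.norm_exp, hq, ← Real.exp_nat_mul]
      refine Real.exp_le_exp.2 ?_
      have e1 : (-Real.pi * ((1 / d : ℝ) : ℂ) * n ^ 2 +
          2 * Real.pi * (-Complex.I * s) * n) =
          ((-Real.pi * (1 / d) * n ^ 2 : ℝ) : ℂ) + ((-(2 * Real.pi * s * n) : ℝ) : ℂ) *
            Complex.I := by push_cast; ring
      rw [e1, Complex.add_re, Complex.re_ofReal_mul, Complex.I_re, mul_zero, add_zero,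
        Complex.ofReal_re]
      have h2 : (n.natAbs : ℝ) ≤ (n : ℝ) ^ 2 := by
        rw [Nat.cast_natAbs]
        exact_mod_cast Int.natCast_natAbs n ▸ Int.natAbs_le_self_sq n
      have h3 : 0 ≤ Real.pi / d := by positivity
      have := mul_le_mul_of_nonneg_left h2 h3
      calc -Real.pi * (1 / d) * (n : ℝ) ^ 2 = -(Real.pi / d * (n : ℝ) ^ 2) := by ring
        _ ≤ -(Real.pi / d * (n.natAbs : ℝ)) := neg_le_neg this
        _ = _ := by ring
  have hs1 : HasSum (fun n : ℤ => if n = 0 then (1 : ℂ) else 0) 1 := hasSum_ite_eq 0 1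
  have hs2 : Summable fun n : ℤ => g n - if n = 0 then 1 else 0 :=
    Summable.of_norm_bounded hb.summable hle
  have hs3 : Summable g := by
    simpa using hs2.add hs1.summable
  have hfin : ‖(∑' n, g n) - 1‖ ≤ 2 * q / (1 - q) := by
    rw [← hs1.tsum_eq, ← hs3.tsum_sub hs1.summable]
    exact tsum_of_norm_bounded hb hle
  rw [hP, ← Complex.ofReal_one, ← Complex.ofReal_sub, Complex.norm_real] at hfin
  exact hfin

/-- Gaussian sums over two shifts of `ℤ` differ by a factor close to `1`. -/
theorem tsum_gaussian_shift_le {d : ℝ} (hd : 0 < d) (s s' : ℝ) :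
    (1 - 2 * (2 * Real.exp (-Real.pi / d) / (1 - Real.exp (-Real.pi / d)))) *
        ∑' j : ℤ, Real.exp (-Real.pi * (d * ((j : ℝ) + s') ^ 2)) ≤
      ∑' j : ℤ, Real.exp (-Real.pi * (d * ((j : ℝ) + s) ^ 2)) := by
  obtain ⟨K, hK, h⟩ := exists_abs_mul_tsum_gaussian_sub_one_le hd
  have h1 := abs_le.1 (h s)
  have h2 := abs_le.1 (h s')
  set e := 2 * Real.exp (-Real.pi / d) / (1 - Real.exp (-Real.pi / d))
  have hT : ∀ s : ℝ, 0 ≤ ∑' j : ℤ, Real.exp (-Real.pi * (d * ((j : ℝ) + s) ^ 2)) :=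
    fun s => tsum_nonneg fun _ => (Real.exp_pos _).le
  have hTs := hT s
  have hTs' := hT s'
  set T := ∑' j : ℤ, Real.exp (-Real.pi * (d * ((j : ℝ) + s) ^ 2))
  set T' := ∑' j : ℤ, Real.exp (-Real.pi * (d * ((j : ℝ) + s') ^ 2))
  by_cases he : 1 - 2 * e ≤ 0
  · exact (mul_nonpos_of_nonpos_of_nonneg he hTs').trans hTs
  · refine le_of_mul_le_mul_left ?_ hK
    nlinarith [sq_nonneg e]

/-- Summable nonnegative functions on a group, compared coset by coset along a cyclic subgroup. -/
theorem mul_tsum_le_tsum_of_zmultiples {G : Type*} [AddCommGroup G] {f f' : G → ℝ} {r : ℝ}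
    (hf : Summable f) (hf' : Summable f') (b : G)
    (hb : Function.Injective fun j : ℤ => j • b)
    (h : ∀ a, r * ∑' j : ℤ, f' (a + j • b) ≤ ∑' j : ℤ, f (a + j • b)) :
    r * ∑' a, f' a ≤ ∑' a, f a := by
  let H := AddSubgroup.zmultiples b
  have hbij : Function.Bijective fun p : (G ⧸ H) × ℤ => p.1.out + p.2 • b := by
    have hmk : ∀ p : (G ⧸ H) × ℤ, ((p.1.out + p.2 • b : G) : G ⧸ H) = p.1 := fun p => by
      rw [QuotientAddGroup.mk_add_of_mem _ (AddSubgroup.zsmul_mem_zmultiples b p.2)]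
      exact Quotient.out_eq' p.1
    constructor
    · rintro p p' hp
      have h1 : p.1 = p'.1 := by
        rw [← hmk p, ← hmk p']
        exact congrArg _ hp
      refine Prod.ext h1 (hb ?_)
      simpa [h1] using hp
    · intro a
      have ha : ((a : G ⧸ H).out : G ⧸ H) = a := Quotient.out_eq' _
      obtain ⟨j, hj⟩ := AddSubgroup.mem_zmultiples_iff.1 (QuotientAddGroup.eq.1 ha)
      exact ⟨(a, j), by simp [hj]⟩
  let E := Equiv.ofBijective _ hbij
  have hE : ∀ p, E p = p.1.out + p.2 • b := fun p => rfl
  have hs : Summable fun p => f (E p) := E.summable_iff.2 hf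
  have hs' : Summable fun p => f' (E p) := E.summable_iff.2 hf'
  rw [← E.tsum_eq f, ← E.tsum_eq f', Summable.tsum_prod hs, Summable.tsum_prod hs', ← tsum_mul_left]
  refine Summable.tsum_le_tsum (fun g => ?_) (hs'.prod.mul_left r) hs.prod
  simpa only [hE] using h g.out

/-- The value of a symmetric form along a line, with the square completed. -/
theorem dotProduct_mulVec_add_smul {m : ℕ} {M : Matrix (Fin m) (Fin m) ℝ} (hM : Mᵀ = M)
    (x b : Fin m → ℝ) (hb : b ⬝ᵥ (M *ᵥ b) ≠ 0) (t : ℝ) :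
    (x + t • b) ⬝ᵥ (M *ᵥ (x + t • b)) =
      (b ⬝ᵥ (M *ᵥ b)) * (t + (b ⬝ᵥ (M *ᵥ x)) / (b ⬝ᵥ (M *ᵥ b))) ^ 2 +
        (x ⬝ᵥ (M *ᵥ x) - (b ⬝ᵥ (M *ᵥ x)) ^ 2 / (b ⬝ᵥ (M *ᵥ b))) := by
  have hsymm : x ⬝ᵥ (M *ᵥ b) = b ⬝ᵥ (M *ᵥ x) := by
    rw [Matrix.dotProduct_mulVec, ← Matrix.mulVec_transpose, hM, dotProduct_comm]
  simp only [Matrix.mulVec_add, Matrix.mulVec_smul, dotProduct_add, add_dotProduct,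
    smul_dotProduct, dotProduct_smul, smul_eq_mul, hsymm]
  field_simp
  ring

/-- The Gaussian mass of a shifted integral lattice, with respect to a quadratic form. -/
noncomputable def gaussianSum {m : ℕ} (M : Matrix (Fin m) (Fin m) ℝ)
    (A : AddSubgroup (Fin m → ℤ)) (y : Fin m → ℝ) : ℝ :=
  ∑' a : A, Real.exp (-Real.pi * ((intCast' a.1 + y) ⬝ᵥ (M *ᵥ (intCast' a.1 + y))))

theorem gaussianSum_add_smul_ge {m : ℕ} {M : Matrix (Fin m) (Fin m) ℝ} (hM : Mᵀ = M)
    {A : AddSubgroup (Fin m → ℤ)}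
    (hsum : ∀ y : Fin m → ℝ, Summable fun a : A =>
      Real.exp (-Real.pi * ((intCast' a.1 + y) ⬝ᵥ (M *ᵥ (intCast' a.1 + y)))))
    (b : Fin m → ℤ) (hbA : b ∈ A) (hb : 0 < intCast' b ⬝ᵥ (M *ᵥ intCast' b))
    (y : Fin m → ℝ) (t : ℝ) :
    (1 - 2 * (2 * Real.exp (-Real.pi / (intCast' b ⬝ᵥ (M *ᵥ intCast' b))) /
      (1 - Real.exp (-Real.pi / (intCast' b ⬝ᵥ (M *ᵥ intCast' b)))))) * gaussianSum M A y ≤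
      gaussianSum M A (y + t • intCast' b) := by
  have hb0 : b ≠ 0 := by
    rintro rfl
    have h0 : intCast' (0 : Fin m → ℤ) = 0 := by ext; simp [intCast']
    simp [h0] at hb
  refine mul_tsum_le_tsum_of_zmultiples (hsum _) (hsum y) (⟨b, hbA⟩ : A) ?_ ?_
  · intro j k hjk
    have h1 : j • b = k • b := congrArg Subtype.val hjk
    exact smul_left_injective ℤ hb0 h1
  · intro a
    set d := intCast' b ⬝ᵥ (M *ᵥ intCast' b) with hd
    set x := intCast' a.1 + y with hx
    have key : ∀ (t : ℝ) (j : ℤ),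
        Real.exp (-Real.pi * ((intCast' (a + j • (⟨b, hbA⟩ : A)).1 + (y + t • intCast' b)) ⬝ᵥ
          (M *ᵥ (intCast' (a + j • (⟨b, hbA⟩ : A)).1 + (y + t • intCast' b))))) =
        Real.exp (-Real.pi * (d * ((j : ℝ) + (t + (intCast' b ⬝ᵥ (M *ᵥ x)) / d)) ^ 2)) *
        Real.exp (-Real.pi * (x ⬝ᵥ (M *ᵥ x) - (intCast' b ⬝ᵥ (M *ᵥ x)) ^ 2 / d)) := by
      intro t j
      have e : intCast' (a + j • (⟨b, hbA⟩ : A)).1 + (y + t • intCast' b) =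
          x + ((j : ℝ) + t) • intCast' b := by
        ext i
        simp [hx, intCast']
        ring
      rw [e, dotProduct_mulVec_add_smul hM _ _ hb.ne', ← Real.exp_add]
      congr 1
      ring
    have key0 := key 0
    simp only [zero_smul, add_zero, zero_add] at key0
    simp_rw [key t, key0, tsum_mul_right]
    rw [← mul_assoc]
    exact mul_le_mul_of_nonneg_right (tsum_gaussian_shift_le hb _ _) (Real.exp_pos _).le

theorem pow_card_mul_gaussianSum_le {m : ℕ} {M : Matrix (Fin m) (Fin m) ℝ} (hM : Mᵀ = M)
    {A : AddSubgroup (Fin m → ℤ)}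
    (hsum : ∀ y : Fin m → ℝ, Summable fun a : A =>
      Real.exp (-Real.pi * ((intCast' a.1 + y) ⬝ᵥ (M *ᵥ (intCast' a.1 + y)))))
    {ι : Type*} (b : ι → Fin m → ℤ) (hbA : ∀ i, b i ∈ A)
    (hb : ∀ i, 0 < intCast' (b i) ⬝ᵥ (M *ᵥ intCast' (b i))) {q : ℝ} (hq1 : q < 1)
    (hq : ∀ i, Real.exp (-Real.pi / (intCast' (b i) ⬝ᵥ (M *ᵥ intCast' (b i)))) ≤ q)
    (hq2 : 0 ≤ 1 - 2 * (2 * q / (1 - q)))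
    (t : ι → ℝ) (y : Fin m → ℝ) (s : Finset ι) :
    (1 - 2 * (2 * q / (1 - q))) ^ s.card * gaussianSum M A y ≤
      gaussianSum M A (y + ∑ i ∈ s, t i • intCast' (b i)) := by
  induction s using Finset.induction_on with
  | empty => simp
  | insert i s hi ih =>
    rw [Finset.card_insert_of_notMem hi, Finset.sum_insert hi, pow_succ', mul_assoc,
      add_comm (t i • _), ← add_assoc]
    refine (mul_le_mul_of_nonneg_left ih hq2).trans
      (le_trans ?_ (gaussianSum_add_smul_ge hM hsum (b i) (hbA i) (hb i) _ (t i)))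
    refine mul_le_mul_of_nonneg_right ?_ (tsum_nonneg fun _ => (Real.exp_pos _).le)
    have h1 : 0 < 1 - q := by linarith
    have h2 := hq i
    have h3 : 0 ≤ q := (Real.exp_pos _).le.trans h2
    gcongr

theorem summable_prod_comp_apply {m : ℕ} (f : Fin m → ℤ → ℝ) (h0 : ∀ i j, 0 ≤ f i j)
    (hf : ∀ i, Summable (f i)) : Summable fun v : Fin m → ℤ => ∏ i, f i (v i) := by
  induction m with
  | zero => exact .of_finite
  | succ m ih =>
    rw [← (Fin.consEquiv fun _ => ℤ).summable_iff]
    have h := (hf 0).mul_of_nonneg (ih (fun i => f i.succ) (fun i => h0 _) fun i => hf _)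
      (h0 0) (fun v => Finset.prod_nonneg fun i _ => h0 _ _)
    refine h.congr fun p => ?_
    simp [Fin.prod_univ_succ, Fin.consEquiv]

/-- A Gaussian bounded below by a multiple of the standard form is summable over shifts of
`ℤ^m`. -/
theorem summable_exp_neg_dotProduct_mulVec {m : ℕ} {M : Matrix (Fin m) (Fin m) ℝ} {κ : ℝ}
    (hκ : 0 < κ) (hM : ∀ x : Fin m → ℝ, κ * ∑ i, x i ^ 2 ≤ x ⬝ᵥ (M *ᵥ x)) (y : Fin m → ℝ) :
    Summable fun v : Fin m → ℤ =>
      Real.exp (-Real.pi * ((intCast' v + y) ⬝ᵥ (M *ᵥ (intCast' v + y)))) := by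
  have h := summable_prod_comp_apply
    (fun i j => Real.exp (-Real.pi * (κ * ((j : ℝ) + y i) ^ 2)))
    (fun _ _ => (Real.exp_pos _).le) (fun i => summable_exp_neg_mul_sq_int_add hκ (y i))
  refine Summable.of_nonneg_of_le (fun _ => (Real.exp_pos _).le) (fun v => ?_) h
  rw [← Real.exp_sum, ← Finset.mul_sum, ← Finset.mul_sum]
  refine Real.exp_le_exp.2 ?_
  have := mul_le_mul_of_nonneg_left (hM (intCast' v + y)) Real.pi_pos.le
  simp only [Pi.add_apply, intCast'] at this ⊢
  linarith

theorem transpose_inv_transpose_mul_self {m n : ℕ} (S : Matrix (Fin m) (Fin n) ℝ) :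
    ((Sᵀ * S)⁻¹)ᵀ = (Sᵀ * S)⁻¹ := by
  rw [Matrix.transpose_nonsing_inv, Matrix.transpose_mul, Matrix.transpose_transpose]

theorem dotProduct_inv_transpose_mul_self_mulVec {m : ℕ} (R : Matrix (Fin m) (Fin m) ℝ)
    (x : Fin m → ℝ) :
    x ⬝ᵥ ((Rᵀ * R)⁻¹ *ᵥ x) = ∑ i, (((R⁻¹)ᵀ *ᵥ x) i) ^ 2 := by
  rw [Matrix.mul_inv_rev, ← Matrix.transpose_nonsing_inv, ← Matrix.mulVec_mulVec,
    Matrix.dotProduct_mulVec, ← Matrix.mulVec_transpose]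
  simp [dotProduct, sq]

theorem exists_pos_mul_sum_sq_le {m : ℕ} {R : Matrix (Fin m) (Fin m) ℝ} (hR : IsUnit R.det) :
    ∃ κ : ℝ, 0 < κ ∧ ∀ x : Fin m → ℝ, κ * ∑ i, x i ^ 2 ≤ x ⬝ᵥ ((Rᵀ * R)⁻¹ *ᵥ x) := by
  have hC : 0 < 1 + ∑ i, ∑ j, R j i ^ 2 := by positivity
  refine ⟨(1 + ∑ i, ∑ j, R j i ^ 2)⁻¹, inv_pos.2 hC, fun x => ?_⟩
  rw [inv_mul_le_iff₀ hC, dotProduct_inv_transpose_mul_self_mulVec]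
  set y := (R⁻¹)ᵀ *ᵥ x with hy
  have hx : x = Rᵀ *ᵥ y := by
    rw [hy, Matrix.mulVec_mulVec, ← Matrix.transpose_mul, Matrix.nonsing_inv_mul _ hR,
      Matrix.transpose_one, Matrix.one_mulVec]
  have h : ∑ i, x i ^ 2 ≤ (∑ i, ∑ j, R j i ^ 2) * ∑ i, y i ^ 2 := by
    rw [hx, Finset.sum_mul]
    refine Finset.sum_le_sum fun i _ => ?_
    exact Finset.sum_mul_sq_le_sq_mul_sq Finset.univ (fun j => R j i) y
  have : 0 ≤ ∑ i, y i ^ 2 := by positivity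
  linarith

theorem dotProduct_inv_transpose_mul_self_mulVec_pos {m : ℕ} {R : Matrix (Fin m) (Fin m) ℝ}
    (hR : IsUnit R.det) {x : Fin m → ℝ} (hx : x ≠ 0) : 0 < x ⬝ᵥ ((Rᵀ * R)⁻¹ *ᵥ x) := by
  obtain ⟨κ, hκ, h⟩ := exists_pos_mul_sum_sq_le hR
  refine lt_of_lt_of_le (mul_pos hκ ?_) (h x)
  obtain ⟨i, hi⟩ := Function.ne_iff.1 hx
  exact Finset.sum_pos' (fun _ _ => sq_nonneg _) ⟨i, Finset.mem_univ _, by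
    have : x i ≠ 0 := hi
    positivity⟩

theorem enorm'_sq {k : ℕ} (x : Fin k → ℝ) : enorm' x ^ 2 = ∑ i, x i ^ 2 :=
  Real.sq_sqrt (Finset.sum_nonneg fun _ _ => sq_nonneg _)

theorem enorm'_nonneg {k : ℕ} (x : Fin k → ℝ) : 0 ≤ enorm' x := Real.sqrt_nonneg _

/-- A lower bound for the least singular value bounds the inverse Gram form from above. -/
theorem sq_mul_dotProduct_inv_le {m : ℕ} {R : Matrix (Fin m) (Fin m) ℝ}
    {σ : ℝ} (hσ : 0 ≤ σ) (h : ∀ x : Fin m → ℝ, σ * enorm' x ≤ enorm' (R *ᵥ x))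
    (hR : IsUnit R.det) (x : Fin m → ℝ) :
    σ ^ 2 * (x ⬝ᵥ ((Rᵀ * R)⁻¹ *ᵥ x)) ≤ ∑ i, x i ^ 2 := by
  have hQ := dotProduct_inv_transpose_mul_self_mulVec R x
  set p := (Rᵀ * R)⁻¹ *ᵥ x with hp
  have hRp : R *ᵥ p = (R⁻¹)ᵀ *ᵥ x := by
    rw [hp, Matrix.mulVec_mulVec, Matrix.mul_inv_rev, ← Matrix.mul_assoc,
      Matrix.mul_nonsing_inv _ hR, Matrix.one_mul, Matrix.transpose_nonsing_inv]
  have h1 : σ ^ 2 * ∑ i, p i ^ 2 ≤ x ⬝ᵥ p := by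
    rw [hQ, ← hRp, ← enorm'_sq, ← enorm'_sq, ← mul_pow]
    exact pow_le_pow_left₀ (mul_nonneg hσ (enorm'_nonneg _)) (h p) 2
  have h2 : (x ⬝ᵥ p) ^ 2 ≤ (∑ i, x i ^ 2) * ∑ i, p i ^ 2 :=
    Finset.sum_mul_sq_le_sq_mul_sq _ _ _
  have hQ0 : 0 ≤ x ⬝ᵥ p := by rw [hQ]; positivity
  have hx0 : 0 ≤ ∑ i, x i ^ 2 := by positivity
  rcases hQ0.eq_or_lt with h0 | h0
  · rw [← h0, mul_zero]; exact hx0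
  · refine le_of_mul_le_mul_right ?_ h0
    calc σ ^ 2 * (x ⬝ᵥ p) * (x ⬝ᵥ p) = σ ^ 2 * (x ⬝ᵥ p) ^ 2 := by ring
      _ ≤ σ ^ 2 * ((∑ i, x i ^ 2) * ∑ i, p i ^ 2) := by gcongr
      _ = (∑ i, x i ^ 2) * (σ ^ 2 * ∑ i, p i ^ 2) := by ring
      _ ≤ _ := by gcongr

/-- Orthogonal splitting of the inverse Gram form along the fibres of `Y`. -/
theorem exists_dotProduct_inv_split {n m : ℕ} {R : Matrix (Fin m) (Fin m) ℝ}
    (hR : IsUnit R.det) {Y : Matrix (Fin n) (Fin m) ℝ} {U : Matrix (Fin m) (Fin n) ℝ}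
    (hYU : Y * U = 1) (z : Fin n → ℝ) :
    ∃ p : Fin m → ℝ, Y *ᵥ p = z ∧ ∀ x : Fin m → ℝ, Y *ᵥ x = z →
      x ⬝ᵥ ((Rᵀ * R)⁻¹ *ᵥ x) =
        z ⬝ᵥ (((R * Yᵀ)ᵀ * (R * Yᵀ))⁻¹ *ᵥ z) + (x - p) ⬝ᵥ ((Rᵀ * R)⁻¹ *ᵥ (x - p)) := by
  set S := R * Yᵀ with hS
  have hSinj : ∀ v, S *ᵥ v = 0 → v = 0 := by
    intro v hv
    have h1 : Yᵀ *ᵥ v = 0 := by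
      have := congrArg (R⁻¹ *ᵥ ·) hv
      simpa [hS, ← Matrix.mul_assoc, Matrix.nonsing_inv_mul _ hR] using this
    have h2 : Uᵀ * Yᵀ = 1 := by rw [← Matrix.transpose_mul, hYU, Matrix.transpose_one]
    have := congrArg (Uᵀ *ᵥ ·) h1
    simpa [h2] using this
  have hG : IsUnit (Sᵀ * S).det := by
    rw [isUnit_iff_ne_zero]
    intro h0
    obtain ⟨v, hv, hv0⟩ := Matrix.exists_mulVec_eq_zero_iff.2 h0
    refine hv (hSinj v ?_)
    have : (S *ᵥ v) ⬝ᵥ (S *ᵥ v) = 0 := by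
      rw [Matrix.dotProduct_mulVec, ← Matrix.mulVec_transpose, Matrix.mulVec_mulVec, hv0,
        zero_dotProduct]
    exact dotProduct_self_eq_zero.1 this
  have hRR : IsUnit (Rᵀ * R).det := by
    rw [Matrix.det_mul, Matrix.det_transpose]; exact hR.mul hR
  set g := (Sᵀ * S)⁻¹ *ᵥ z with hg
  have hSS : Sᵀ * S = Y * (Rᵀ * R) * Yᵀ := by
    simp [hS, Matrix.transpose_mul, Matrix.mul_assoc]
  set p := (Rᵀ * R) *ᵥ (Yᵀ *ᵥ g) with hp
  have hYp : Y *ᵥ p = z := by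
    rw [hp, Matrix.mulVec_mulVec, Matrix.mulVec_mulVec, ← hSS, hg,
      Matrix.mulVec_mulVec, Matrix.mul_nonsing_inv _ hG, Matrix.one_mulVec]
  have hMp : (Rᵀ * R)⁻¹ *ᵥ p = Yᵀ *ᵥ g := by
    rw [hp, Matrix.mulVec_mulVec, Matrix.nonsing_inv_mul _ hRR, Matrix.one_mulVec]
  refine ⟨p, hYp, fun x hx => ?_⟩
  have hdot : ∀ v, v ⬝ᵥ (Yᵀ *ᵥ g) = (Y *ᵥ v) ⬝ᵥ g := fun v => by
    rw [Matrix.dotProduct_mulVec, ← Matrix.mulVec_transpose, Matrix.transpose_transpose]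
  have hsymm : p ⬝ᵥ ((Rᵀ * R)⁻¹ *ᵥ x) = z ⬝ᵥ g := by
    rw [Matrix.dotProduct_mulVec, ← Matrix.mulVec_transpose, transpose_inv_transpose_mul_self,
      hMp, dotProduct_comm, hdot, hx]
  rw [Matrix.mulVec_sub, sub_dotProduct, dotProduct_sub, dotProduct_sub, hMp, hsymm, hdot, hdot,
    hx, hYp]
  ring

/-- The kernel of a matrix of good quality is spanned by short integral vectors. -/
theorem HasQuality.exists_short_spanning {n m : ℕ} {X : Matrix (Fin n) (Fin m) ℤ} {q1 q2 : ℝ}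
    (hq1 : 0 < q1) (hq2 : 0 < q2) (hX : HasQuality X q1 q2) :
    ∃ U : Matrix (Fin m) (Fin n) ℤ, X * U = 1 ∧
      ∃ b : Fin m → Fin m → ℤ, (∀ j, X *ᵥ b j = 0) ∧
        (∀ j, ∑ i, (intCast' (b j) i) ^ 2 ≤ (1 + q1 * q2) ^ 2) ∧
        ∀ x : Fin m → ℝ, X.map (Int.cast : ℤ → ℝ) *ᵥ x = 0 → ∑ j, x j • intCast' (b j) = x := by
  obtain ⟨hcol, u, horth, hdual, hnorm⟩ := hX
  have hXU : X * (Matrix.of u)ᵀ = 1 := by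
    ext i j
    rw [Matrix.mul_apply, Matrix.one_apply]
    simp only [Matrix.transpose_apply, Matrix.of_apply]
    rw [← (by simpa [mul_comm, eq_comm] using hdual j i :
      ∑ l, X i l * u j l = if i = j then 1 else 0)]
  have hb : ∀ j l, intCast' (Pi.single j 1 - (Matrix.of u)ᵀ *ᵥ X.col j) l =
      (if l = j then 1 else 0) - ∑ i, (X i j : ℝ) * u i l := by
    intro j l
    simp [intCast', Matrix.mulVec, dotProduct, Pi.single_apply, mul_comm]
  refine ⟨(Matrix.of u)ᵀ, hXU, fun j => Pi.single j 1 - (Matrix.of u)ᵀ *ᵥ X.col j, ?_, ?_, ?_⟩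
  · intro j
    rw [Matrix.mulVec_sub, Matrix.mulVec_mulVec, hXU, Matrix.one_mulVec, Matrix.mulVec_single_one,
      sub_self]
  · intro j
    set w : Fin m → ℝ := fun l => ∑ i, (X i j : ℝ) * u i l with hw
    have hw2 : ∑ l, w l ^ 2 ≤ (q1 * q2) ^ 2 := by
      have e : ∑ l, w l ^ 2 = ∑ i, (X i j : ℝ) ^ 2 * ∑ l, (u i l : ℝ) ^ 2 := by
        have e1 : ∀ l, w l ^ 2 = ∑ i, ∑ i', (X i j : ℝ) * X i' j * (u i l * u i' l) := by
          intro l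
          rw [hw, sq, Finset.sum_mul_sum]
          refine Finset.sum_congr rfl fun i _ => Finset.sum_congr rfl fun i' _ => by ring
        simp_rw [e1]
        rw [Finset.sum_comm]
        refine Finset.sum_congr rfl fun i _ => ?_
        rw [Finset.sum_comm, Finset.sum_eq_single i]
        · rw [← Finset.mul_sum, sq]
          congr 1
          exact Finset.sum_congr rfl fun l _ => (sq _).symm
        · intro i' _ hne
          rw [← Finset.mul_sum]
          have : ∑ l, (u i l : ℝ) * u i' l = 0 := by exact_mod_cast horth i i' hne.symm
          rw [this, mul_zero]
        · simp
      rw [e, mul_pow]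
      have h1 : ∑ i, (X i j : ℝ) ^ 2 ≤ q1 ^ 2 := (Real.sqrt_le_left hq1.le).1 (hcol j)
      have h2 : ∀ i, ∑ l, (u i l : ℝ) ^ 2 ≤ q2 ^ 2 := fun i =>
        (Real.sqrt_le_left hq2.le).1 (hnorm i)
      calc _ ≤ ∑ i, (X i j : ℝ) ^ 2 * q2 ^ 2 :=
            Finset.sum_le_sum fun i _ => mul_le_mul_of_nonneg_left (h2 i) (sq_nonneg _)
        _ = (∑ i, (X i j : ℝ) ^ 2) * q2 ^ 2 := by rw [Finset.sum_mul]
        _ ≤ _ := by gcongr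
    have hwj : w j ^ 2 ≤ (q1 * q2) ^ 2 :=
      (Finset.single_le_sum (f := fun l => w l ^ 2) (fun _ _ => sq_nonneg _)
        (Finset.mem_univ j)).trans hw2
    have hwj' : -(q1 * q2) ≤ w j :=
      (abs_le.1 (abs_le_of_sq_le_sq hwj (by positivity))).1
    have e2 : ∑ l, intCast' (Pi.single j 1 - (Matrix.of u)ᵀ *ᵥ X.col j) l ^ 2 =
        1 - 2 * w j + ∑ l, w l ^ 2 := by
      have e3 : ∀ l, intCast' (Pi.single j 1 - (Matrix.of u)ᵀ *ᵥ X.col j) l ^ 2 =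
          (if l = j then 1 - 2 * w l else 0) + w l ^ 2 := by
        intro l
        rw [hb]
        change ((if l = j then 1 else 0) - w l) ^ 2 = _
        split_ifs <;> ring
      simp_rw [e3, Finset.sum_add_distrib]
      simp
    rw [e2]
    nlinarith
  · intro x hx
    ext l
    simp only [Finset.sum_apply, Pi.smul_apply, smul_eq_mul, hb, mul_sub, Finset.sum_sub_distrib,
      Finset.mul_sum]
    rw [Finset.sum_comm]
    have h0 : ∀ i, ∑ j, x j * ((X i j : ℝ) * u i l) = 0 := fun i => by
      have h1 : ∑ j, (X i j : ℝ) * x j = 0 := congrFun hx i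
      rw [← zero_mul (u i l : ℝ), ← h1, Finset.sum_mul]
      exact Finset.sum_congr rfl fun j _ => by ring
    simp [h0]

/-- Reweighting a distribution by nearly constant weights changes it little. -/
theorem half_tsum_abs_reweight_sub_le {ι : Type*} [Nonempty ι] {a s : ι → ℝ} {r : ℝ}
    (ha : ∀ w, 0 < a w) (hs : ∀ w, 0 < s w) (hr : 0 < r) (hr1 : r ≤ 1)
    (hss : ∀ w w', r * s w' ≤ s w) (hsum : Summable fun w => a w * s w) :
    (1 / 2) * ∑' w, |a w * s w / (∑' u, a u * s u) - a w / ∑' u, a u| ≤ 1 - r := by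
  have w₀ : ι := Classical.arbitrary ι
  have hsa : Summable a := by
    have h : Summable fun w => a w * (r * s w₀) :=
      Summable.of_nonneg_of_le
        (fun w => mul_nonneg (ha w).le (mul_nonneg hr.le (hs w₀).le))
        (fun w => mul_le_mul_of_nonneg_left (hss w w₀) (ha w).le) hsum
    exact (summable_mul_right_iff (mul_pos hr (hs w₀)).ne').1 h
  have hA : 0 < ∑' u, a u := hsa.tsum_pos (fun w => (ha w).le) w₀ (ha w₀)
  have hS : 0 < ∑' u, a u * s u :=
    hsum.tsum_pos (fun w => (mul_pos (ha w) (hs w)).le) w₀ (mul_pos (ha w₀) (hs w₀))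
  set A := ∑' u, a u with hAdef
  set S := ∑' u, a u * s u with hSdef
  have hle : ∀ w, r * S ≤ s w * A := fun w => by
    rw [hAdef, hSdef, ← tsum_mul_left, ← tsum_mul_left]
    refine Summable.tsum_le_tsum (fun u => ?_) (hsum.mul_left r) (hsa.mul_left _)
    have := mul_le_mul_of_nonneg_left (hss w u) (ha u).le
    linarith
  have hPQ : ∀ w, r * (a w / A) ≤ a w * s w / S := fun w => by
    rw [mul_div_assoc', div_le_div_iff₀ hA hS]
    have := mul_le_mul_of_nonneg_left (hle w) (ha w).le
    linarith
  have hP : HasSum (fun w => a w * s w / S) 1 := by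
    simpa [← hSdef, hS.ne'] using hsum.hasSum.div_const S
  have hQ : HasSum (fun w => a w / A) 1 := by
    simpa [← hAdef, hA.ne'] using hsa.hasSum.div_const A
  have hbound : ∀ w, |a w * s w / S - a w / A| ≤
      (a w * s w / S - r * (a w / A)) + (1 - r) * (a w / A) := fun w => by
    have h1 := hPQ w
    have h2 : 0 ≤ a w / A := (div_pos (ha w) hA).le
    have h3 := mul_nonneg (sub_nonneg.2 hr1) h2
    rw [abs_le]
    constructor <;> linarith
  have hR := (hP.sub (hQ.mul_left r)).add (hQ.mul_left (1 - r))
  have := Summable.tsum_le_tsum hbound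
    (Summable.of_nonneg_of_le (fun _ => abs_nonneg _) hbound hR.summable) hR.summable
  rw [hR.tsum_eq] at this
  linarith

/-- A lattice shift is determined by its image under `X` and an element of the kernel of `X`. -/
theorem bijective_mulVec_add_ker {n m : ℕ} {X : Matrix (Fin n) (Fin m) ℤ}
    {U : Matrix (Fin m) (Fin n) ℤ} (hXU : X * U = 1) :
    Function.Bijective fun p : (Fin n → ℤ) × X.mulVecLin.toAddMonoidHom.ker =>
      U *ᵥ p.1 + p.2.1 := by
  have hX : ∀ p : (Fin n → ℤ) × X.mulVecLin.toAddMonoidHom.ker,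
      X *ᵥ (U *ᵥ p.1 + p.2.1) = p.1 := fun p => by
    have : X *ᵥ p.2.1 = 0 := p.2.2
    rw [Matrix.mulVec_add, Matrix.mulVec_mulVec, hXU, this, Matrix.one_mulVec, add_zero]
  constructor
  · rintro p p' hp
    have h1 : p.1 = p'.1 := by
      rw [← hX p, ← hX p']
      exact congrArg (X *ᵥ ·) hp
    refine Prod.ext h1 (Subtype.ext ?_)
    simpa [h1] using hp
  · intro v
    refine ⟨(X *ᵥ v, ⟨v - U *ᵥ (X *ᵥ v), ?_⟩), by simp⟩
    change X *ᵥ (v - U *ᵥ (X *ᵥ v)) = 0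
    rw [Matrix.mulVec_sub, Matrix.mulVec_mulVec, hXU, Matrix.one_mulVec, sub_self]

theorem intCast'_add {k : ℕ} (v w : Fin k → ℤ) : intCast' (v + w) = intCast' v + intCast' w := by
  ext; simp [intCast']

theorem intCast'_mulVec {n m : ℕ} (X : Matrix (Fin n) (Fin m) ℤ) (v : Fin m → ℤ) :
    intCast' (X *ᵥ v) = X.map (Int.cast : ℤ → ℝ) *ᵥ intCast' v := by
  ext; simp [intCast', Matrix.mulVec, dotProduct]

theorem intCast'_injective {k : ℕ} : Function.Injective (intCast' (k := k)) := fun v w h => by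
  ext i
  exact Int.cast_injective (congrFun h i)

theorem Edist_eq {n m : ℕ} {X : Matrix (Fin n) (Fin m) ℤ} {U : Matrix (Fin m) (Fin n) ℤ}
    (hXU : X * U = 1) {R : Matrix (Fin m) (Fin m) ℝ} (c : Fin m → ℝ)
    (hsum : Summable fun v : Fin m → ℤ => rho R (intCast' v + c)) :
    (Summable fun w : Fin n → ℤ => ∑' a : X.mulVecLin.toAddMonoidHom.ker,
      rho R (intCast' (U *ᵥ w + a.1) + c)) ∧
    ∀ w : Fin n → ℤ, Edist (X.map (Int.cast : ℤ → ℝ)) R c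
        (intCast' w + X.map (Int.cast : ℤ → ℝ) *ᵥ c) =
      (∑' a : X.mulVecLin.toAddMonoidHom.ker, rho R (intCast' (U *ᵥ w + a.1) + c)) /
      ∑' w : Fin n → ℤ, ∑' a : X.mulVecLin.toAddMonoidHom.ker,
        rho R (intCast' (U *ᵥ w + a.1) + c) := by
  let E := Equiv.ofBijective _ (bijective_mulVec_add_ker hXU)
  have hE : ∀ p, E p = U *ᵥ p.1 + p.2.1 := fun p => rfl
  have hs : Summable fun p => rho R (intCast' (E p) + c) :=
    E.summable_iff (f := fun v => rho R (intCast' v + c)).2 hsum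
  refine ⟨hs.prod, fun w => ?_⟩
  rw [Edist]
  congr 1
  · rw [← E.tsum_eq]
    have hcond : ∀ p, (X.map (Int.cast : ℤ → ℝ) *ᵥ (intCast' (E p) + c) =
        intCast' w + X.map (Int.cast : ℤ → ℝ) *ᵥ c) ↔ p.1 = w := fun p => by
      have hp : X *ᵥ p.2.1 = 0 := p.2.2
      rw [Matrix.mulVec_add, add_left_inj, ← intCast'_mulVec, intCast'_injective.eq_iff, hE,
        Matrix.mulVec_add, Matrix.mulVec_mulVec, hXU, hp, Matrix.one_mulVec, add_zero]
    simp_rw [hcond]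
    rw [Summable.tsum_prod (f := fun p => if p.1 = w then rho R (intCast' (E p) + c) else 0),
      tsum_eq_single w]
    · simp [hE]
    · intro w' hw'
      simp [hw']
    · refine Summable.of_nonneg_of_le (fun p => ?_) (fun p => ?_) hs
      · split_ifs
        exacts [(Real.exp_pos _).le, le_rfl]
      · split_ifs
        exacts [le_rfl, (Real.exp_pos _).le]
  · rw [← E.tsum_eq, hs.tsum_prod]
    rfl

theorem map_intCast_mul_map_intCast_eq_one {n m : ℕ} {X : Matrix (Fin n) (Fin m) ℤ}
    {U : Matrix (Fin m) (Fin n) ℤ} (hXU : X * U = 1) :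
    X.map (Int.cast : ℤ → ℝ) * U.map (Int.cast : ℤ → ℝ) = 1 := by
  have h := congrArg (fun Z : Matrix (Fin n) (Fin n) ℤ => Z.map (Int.castRingHom ℝ)) hXU
  simp only [Matrix.map_mul] at h
  rw [Matrix.map_one _ (map_zero _) (map_one _)] at h
  exact h

theorem exists_short_spanning_card {n m : ℕ} {X : Matrix (Fin n) (Fin m) ℤ}
    {U : Matrix (Fin m) (Fin n) ℤ} (hXU : X * U = 1) (b : Fin m → Fin m → ℤ)
    (hb : ∀ j, X *ᵥ b j = 0)
    (hspan : ∀ x : Fin m → ℝ, X.map (Int.cast : ℤ → ℝ) *ᵥ x = 0 →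
      ∑ j, x j • intCast' (b j) = x) :
    ∃ f : Fin (m - n) → Fin m, (∀ i, intCast' (b (f i)) ≠ 0) ∧
      ∀ x : Fin m → ℝ, X.map (Int.cast : ℤ → ℝ) *ᵥ x = 0 →
        ∃ t : Fin (m - n) → ℝ, ∑ i, t i • intCast' (b (f i)) = x := by
  set Y := X.map (Int.cast : ℤ → ℝ) with hY
  have hbY : ∀ j, Y *ᵥ intCast' (b j) = 0 := fun j => by
    rw [hY, ← intCast'_mulVec, hb]
    ext; simp [intCast']
  obtain ⟨κ, f, hf, hsp, hli⟩ := exists_linearIndependent' ℝ fun j => intCast' (b j)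
  have : Finite κ := Finite.of_injective f hf
  have : Fintype κ := Fintype.ofFinite κ
  have hker : Submodule.span ℝ (Set.range fun j => intCast' (b j)) = LinearMap.ker Y.mulVecLin := by
    refine le_antisymm (Submodule.span_le.2 ?_) fun x hx => ?_
    · rintro _ ⟨j, rfl⟩
      exact hbY j
    · rw [← hspan x hx]
      exact Submodule.sum_mem _ fun j _ =>
        Submodule.smul_mem _ _ (Submodule.subset_span ⟨j, rfl⟩)
  have hYU : Y * U.map (Int.cast : ℤ → ℝ) = 1 := map_intCast_mul_map_intCast_eq_one hXU
  have hsurj : Function.Surjective Y.mulVecLin := fun z =>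
    ⟨U.map (Int.cast : ℤ → ℝ) *ᵥ z, by
      rw [Matrix.mulVecLin_apply, Matrix.mulVec_mulVec, hYU, Matrix.one_mulVec]⟩
  have hcard : Fintype.card κ = m - n := by
    have h1 := finrank_span_eq_card hli
    have h2 := Y.mulVecLin.finrank_range_add_finrank_ker
    rw [hsp, hker] at h1
    rw [LinearMap.range_eq_top.2 hsurj, finrank_top, h1] at h2
    simp at h2
    omega
  let e : Fin (m - n) ≃ κ := (Fintype.equivFinOfCardEq hcard).symm
  refine ⟨f ∘ e, fun i => hli.ne_zero (e i), fun x hx => ?_⟩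
  have hx' : x ∈ Submodule.span ℝ (Set.range ((fun j => intCast' (b j)) ∘ f)) := by
    rw [hsp, hker]
    exact hx
  obtain ⟨t, ht⟩ := (Submodule.mem_span_range_iff_exists_fun ℝ).1 hx'
  refine ⟨t ∘ e, ?_⟩
  rw [← ht]
  exact e.sum_comp fun i => t i • intCast' (b (f i))

theorem one_sub_two_mul_le_pow {k : ℕ} (hk : 0 < k) {ε : ℝ} (hε0 : 0 < ε) (hε : ε < 1 / 3) {q : ℝ}
    (hq : q = (2 * (k : ℝ) * (1 + 1 / ε))⁻¹) :
    q < 1 ∧ 0 ≤ 1 - 2 * (2 * q / (1 - q)) ∧ 1 - 2 * (2 * q / (1 - q)) ≤ 1 ∧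
      1 - 2 * ε ≤ (1 - 2 * (2 * q / (1 - q))) ^ k := by
  have hk1 : (1 : ℝ) ≤ k := by exact_mod_cast hk
  have hk0 : (0 : ℝ) < k := by linarith
  have hq0 : 0 < q := by rw [hq]; positivity
  have hkq : 2 * k * q = ε / (1 + ε) := by
    rw [hq]; field_simp; ring
  have hqle : q ≤ ε / (1 + ε) := by nlinarith
  have hlt : ε / (1 + ε) < 1 := by rw [div_lt_one (by linarith)]; linarith
  have hq1 : q < 1 := hqle.trans_lt hlt
  have hke : k * (2 * q / (1 - q)) ≤ ε := by
    rw [mul_div_assoc', div_le_iff₀ (by linarith)]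
    have h1 : ε * (1 - ε / (1 + ε)) = ε / (1 + ε) := by field_simp; ring
    nlinarith
  set e := 2 * q / (1 - q) with he
  have he0 : 0 ≤ e := div_nonneg (by linarith) (by linarith)
  have heε : e ≤ ε := by nlinarith
  refine ⟨hq1, by linarith, by linarith, ?_⟩
  have := one_add_mul_le_pow (a := -(2 * e)) (by linarith) k
  rw [← sub_eq_add_neg] at this
  linarith

/-- Theorem 3.2 of the paper. If `1 ≤ n < m`, `0 < ε < 1/3`, `c ∈ ℝ^m`,
`X ∈ ℤ^{n×m}` has quality `(q1, q2)` with `q1, q2 > 0`, and `R ∈ ℝ^{m×m}` is invertible with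
least singular value at least `(1 + q1·q2)·√(ln(2(m−n)(1 + 1/ε))/π)`, then the statistical
distance between `E_{X,R,c}` and `D_{ℤ^n + Xc, RXᵀ}` is at most `2ε`.  Both distributions are
supported on `ℤ^n + Xc`, whose points are parametrized injectively by `w ∈ ℤ^n`. -/
theorem statement0 {n m : ℕ} (hn : 1 ≤ n) (hm : n < m)
    (ε : ℝ) (hε0 : 0 < ε) (hε : ε < 1 / 3)
    (c : Fin m → ℝ) (q1 q2 : ℝ) (hq1 : 0 < q1) (hq2 : 0 < q2)
    (X : Matrix (Fin n) (Fin m) ℤ) (hX : HasQuality X q1 q2)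
    (R : Matrix (Fin m) (Fin m) ℝ) (hR : IsUnit R.det)
    (hσm : ∀ x : Fin m → ℝ,
      ((1 + q1 * q2) * Real.sqrt (Real.log (2 * ((m : ℝ) - n) * (1 + 1 / ε)) / Real.pi))
          * enorm' x ≤ enorm' (R *ᵥ x)) :
    (1 / 2) * (∑' w : Fin n → ℤ,
        |Edist (X.map (Int.cast : ℤ → ℝ)) R c (intCast' w + (X.map (Int.cast : ℤ → ℝ)) *ᵥ c)
          - rho (R * (X.map (Int.cast : ℤ → ℝ))ᵀ)
                (intCast' w + (X.map (Int.cast : ℤ → ℝ)) *ᵥ c) /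
              (∑' u : Fin n → ℤ,
                rho (R * (X.map (Int.cast : ℤ → ℝ))ᵀ)
                  (intCast' u + (X.map (Int.cast : ℤ → ℝ)) *ᵥ c))|)
      ≤ 2 * ε := by
  set Y := X.map (Int.cast : ℤ → ℝ) with hY
  obtain ⟨U, hXU, b, hb, hbnorm, hbspan⟩ := hX.exists_short_spanning hq1 hq2
  obtain ⟨f, hf0, hfspan⟩ := exists_short_spanning_card hXU b hb hbspan
  have hYU : Y * U.map (Int.cast : ℤ → ℝ) = 1 := map_intCast_mul_map_intCast_eq_one hXU
  set M := (Rᵀ * R)⁻¹ with hMdef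
  have hM : Mᵀ = M := transpose_inv_transpose_mul_self R
  obtain ⟨κ, hκ, hκM⟩ := exists_pos_mul_sum_sq_le hR
  have hsumZ : ∀ y : Fin m → ℝ, Summable fun v : Fin m → ℤ => rho R (intCast' v + y) :=
    summable_exp_neg_dotProduct_mulVec hκ hκM
  obtain ⟨hEsum, hE⟩ := Edist_eq hXU c (hsumZ c)
  set A := X.mulVecLin.toAddMonoidHom.ker with hA
  have hsumA : ∀ y : Fin m → ℝ, Summable fun a : A =>
      Real.exp (-Real.pi * ((intCast' a.1 + y) ⬝ᵥ (M *ᵥ (intCast' a.1 + y)))) :=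
    fun y => (hsumZ y).subtype (A : Set (Fin m → ℤ))
  have hk : 0 < m - n := Nat.sub_pos_of_lt hm
  have hkc : ((m - n : ℕ) : ℝ) = (m : ℝ) - n := Nat.cast_sub hm.le
  obtain ⟨q, hq⟩ : ∃ q : ℝ, q = (2 * ((m - n : ℕ) : ℝ) * (1 + 1 / ε))⁻¹ := ⟨_, rfl⟩
  obtain ⟨hqlt, hr0, hr1, hrpow⟩ := one_sub_two_mul_le_pow hk hε0 hε hq
  have hq0 : 0 < q := by rw [hq]; positivity
  have hlog : Real.log (2 * ((m : ℝ) - n) * (1 + 1 / ε)) = -Real.log q := by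
    rw [hq, Real.log_inv, neg_neg, hkc]
  rw [hlog] at hσm
  have hlog0 : 0 < -Real.log q := neg_pos.2 (Real.log_neg hq0 hqlt)
  have hpos : ∀ i, 0 < intCast' (b (f i)) ⬝ᵥ (M *ᵥ intCast' (b (f i))) := fun i =>
    dotProduct_inv_transpose_mul_self_mulVec_pos hR (hf0 i)
  have hqi : ∀ i, Real.exp (-Real.pi / (intCast' (b (f i)) ⬝ᵥ (M *ᵥ intCast' (b (f i))))) ≤ q := by
    intro i
    have h1 := (sq_mul_dotProduct_inv_le (by positivity) hσm hR _).trans (hbnorm (f i))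
    rw [mul_pow, Real.sq_sqrt (by positivity), mul_assoc] at h1
    have h2 := le_of_mul_le_mul_left (h1.trans_eq (mul_one _).symm) (by positivity)
    rw [div_mul_eq_mul_div, div_le_one Real.pi_pos] at h2
    rw [← Real.le_log_iff_exp_le hq0, div_le_iff₀ (hpos i)]
    linarith
  choose p hYp hsplit using exists_dotProduct_inv_split hR hYU
  set z : (Fin n → ℤ) → Fin n → ℝ := fun w => intCast' w + Y *ᵥ c with hz
  set y : (Fin n → ℤ) → Fin m → ℝ := fun w => intCast' (U *ᵥ w) + c - p (z w) with hy
  have hYU' : ∀ w, Y *ᵥ (intCast' (U *ᵥ w) + c) = z w := fun w => by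
    rw [Matrix.mulVec_add, hY, ← intCast'_mulVec, Matrix.mulVec_mulVec, hXU, Matrix.one_mulVec]
  have hYy : ∀ w, Y *ᵥ y w = 0 := fun w => by
    rw [hy, Matrix.mulVec_sub, hYU', hYp, sub_self]
  have hfac : ∀ w, ∑' a : A, rho R (intCast' (U *ᵥ w + a.1) + c) =
      rho (R * Yᵀ) (z w) * gaussianSum M A (y w) := fun w => by
    rw [gaussianSum, ← tsum_mul_left]
    refine tsum_congr fun a => ?_
    have ha : X *ᵥ a.1 = 0 := a.2
    have hz' : Y *ᵥ (intCast' (U *ᵥ w + a.1) + c) = z w := by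
      rw [Matrix.mulVec_add, hY, ← intCast'_mulVec, Matrix.mulVec_add, Matrix.mulVec_mulVec, hXU,
        Matrix.one_mulVec, ha, add_zero]
    rw [rho, rho, ← Real.exp_add, hsplit (z w) _ hz', mul_add]
    have e : intCast' (U *ᵥ w + a.1) + c - p (z w) = intCast' a.1 + y w := by
      simp only [hy, intCast'_add]
      abel
    rw [e]
  simp_rw [hfac] at hEsum hE
  have hspos : ∀ w, 0 < gaussianSum M A (y w) := fun w =>
    (hsumA _).tsum_pos (fun _ => (Real.exp_pos _).le) 0 (Real.exp_pos _)
  have hss : ∀ w w', (1 - 2 * (2 * q / (1 - q))) ^ (m - n) * gaussianSum M A (y w') ≤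
      gaussianSum M A (y w) := by
    intro w w'
    obtain ⟨t, ht⟩ := hfspan (y w - y w') (by rw [← hY, Matrix.mulVec_sub, hYy, hYy, sub_self])
    have h := pow_card_mul_gaussianSum_le hM hsumA (fun i => b (f i)) (fun i => hb (f i)) hpos
      hqlt hqi hr0 t (y w') Finset.univ
    rwa [ht, add_sub_cancel, Finset.card_univ, Fintype.card_fin] at h
  have hmain := half_tsum_abs_reweight_sub_le (fun w => Real.exp_pos _) hspos
    (lt_of_lt_of_le (by linarith) hrpow) (pow_le_one₀ hr0 hr1) hss hEsum
  simp_rw [← hY] at hE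
  simp_rw [hE]
  exact hmain.trans (by linarith)
end

section
/- Let X ∈ ℤ^{n×m} (m > n) be a matrix of full row rank, let A = {v ∈ ℤ^m : Xv = 0} (a lattice of rank m−n), let R ∈ ℝ^{m×m} be invertible, let c ∈ ℝ^m, and let 0 < ε < 1/3. If ρ_{1/σ_m(R)}(A* ∖ {0}) = Σ_{y ∈ A*∖{0}} exp(−π σ_m(R)² ‖y‖²) ≤ ε (i.e., the least singular value σ_m(R) exceeds the smoothing parameter η_ε(A)), then the statistical distance between E_{X,R,c} and the discrete Gaussian D_{Xℤ^m + Xc, RXᵀ} is at most 2ε. -/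
open scoped BigOperators Matrix
attribute [local instance] Classical.propDecidable

theorem summable_exp_neg_mul_sum_sq {ι : Type*} [Fintype ι] {δ : ℝ} (hδ : 0 < δ) :
    Summable fun n : ι → ℤ => Real.exp (-δ * ∑ i, (n i : ℝ) ^ 2) := by
  have h1 : Summable fun k : ℤ => Real.exp (-δ * (k : ℝ) ^ 2) := by
    have h := summable_pow_mul_jacobiTheta₂_term_bound 0 (div_pos hδ Real.pi_pos) 0
    refine h.congr fun k => ?_
    simp only [pow_zero, one_mul]
    congr 1
    field_simp
    ring
  refine summable_of_sum_le (c := ∏ _i : ι, ∑' k : ℤ, Real.exp (-δ * (k : ℝ) ^ 2))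
    (fun _ => (Real.exp_pos _).le) fun s => ?_
  have hsub : s ⊆ Fintype.piFinset fun i => s.image fun n => n i := fun n hn =>
    Fintype.mem_piFinset.2 fun i => Finset.mem_image_of_mem _ hn
  refine (Finset.sum_le_sum_of_subset_of_nonneg hsub fun _ _ _ => (Real.exp_pos _).le).trans ?_
  simp_rw [Finset.mul_sum, Real.exp_sum]
  rw [← Finset.prod_univ_sum (fun i => s.image fun n => n i)
    (fun _ (k : ℤ) => Real.exp (-δ * (k : ℝ) ^ 2))]
  exact Finset.prod_le_prod (fun _ _ => Finset.sum_nonneg fun _ _ => (Real.exp_pos _).le)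
    fun i _ => h1.sum_le_tsum _ fun _ _ => (Real.exp_pos _).le

/-- The integral of a function over `ℝ^ι` is the sum of the integrals of its integer translates
over a unit cube. -/
theorem tsum_setIntegral_cube_add_intCast {ι : Type*} [Fintype ι] {h : (ι → ℝ) → ℂ}
    (hh : MeasureTheory.Integrable h) :
    ∑' n : ι → ℤ, ∫ x in {x : ι → ℝ | ∀ i, x i ∈ Set.Ioc (0 : ℝ) (0 + 1)},
      h (x + fun i => (n i : ℝ)) = ∫ x, h x := by
  set C : (ι → ℤ) → Set (ι → ℝ) := fun n => {x | ∀ i, x i ∈ Set.Ioc (n i : ℝ) (n i + 1)}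
  have hC : ∀ n, MeasurableSet (C n) := fun n =>
    MeasurableSet.univ_pi' fun i => measurableSet_Ioc
  have hU : (⋃ n, C n) = Set.univ := by
    refine Set.eq_univ_of_forall fun x => Set.mem_iUnion.2 ⟨fun i => ⌈x i⌉ - 1, fun i => ?_⟩
    push_cast
    constructor
    · linarith [Int.ceil_lt_add_one (x i)]
    · linarith [Int.le_ceil (x i)]
  have hD : Pairwise (Function.onFun Disjoint C) := by
    intro n k hnk
    refine Set.disjoint_left.2 fun x hx hx' => hnk (funext fun i => ?_)
    have h1 := hx i
    have h2 := hx' i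
    have h3 : (n i : ℝ) < k i + 1 := h1.1.trans_le h2.2
    have h4 : (k i : ℝ) < n i + 1 := h2.1.trans_le h1.2
    norm_cast at h3 h4
    omega
  rw [← MeasureTheory.setIntegral_univ, ← hU, MeasureTheory.integral_iUnion hC hD hh.integrableOn]
  refine tsum_congr fun n => ?_
  have hp := MeasureTheory.measurePreserving_add_right
    (MeasureTheory.volume : MeasureTheory.Measure (ι → ℝ)) (fun i => (n i : ℝ))
  have he : MeasurableEmbedding fun x : ι → ℝ => x + fun i => (n i : ℝ) :=
    measurableEmbedding_addRight _
  rw [← hp.setIntegral_preimage_emb he h (C n)]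
  congr 2
  ext x
  simp only [C, Set.mem_ofPred_eq, Set.mem_preimage, Set.mem_Ioc, Pi.add_apply]
  refine forall_congr' fun i => ?_
  constructor <;> rintro ⟨h1, h2⟩ <;> constructor <;> linarith

/-- Multidimensional Poisson summation. -/
theorem hasSum_fourier_of_periodization {ι : Type*} [Fintype ι] {g : (ι → ℝ) → ℂ}
    (hg : Continuous g) (hint : MeasureTheory.Integrable g)
    (hb : ∀ r : ℝ, ∃ u : (ι → ℤ) → ℝ, Summable u ∧
      ∀ n x, ‖x‖ < r → ‖g (x + fun i => (n i : ℝ))‖ ≤ u n)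
    (hc : Summable fun l : ι → ℤ =>
      ∫ y, Complex.exp (-2 * Real.pi * Complex.I * ∑ i, (l i : ℂ) * y i) * g y)
    (x : ι → ℝ) :
    HasSum (fun l : ι → ℤ =>
      (∫ y, Complex.exp (-2 * Real.pi * Complex.I * ∑ i, (l i : ℂ) * y i) * g y) *
        Complex.exp (2 * Real.pi * Complex.I * ∑ i, (l i : ℂ) * x i))
      (∑' n : ι → ℤ, g (x + fun i => (n i : ℝ))) := by
  set F : (ι → ℝ) → ℂ := fun x => ∑' n : ι → ℤ, g (x + fun i => (n i : ℝ)) with hF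
  have hFc : Continuous F := by
    refine continuous_iff_continuousAt.2 fun x => ?_
    obtain ⟨u, hu, hbu⟩ := hb (‖x‖ + 1)
    have : ContinuousOn F (Metric.ball 0 (‖x‖ + 1)) :=
      continuousOn_tsum (fun n => by fun_prop) hu fun n y hy => hbu n y (by simpa using hy)
    exact this.continuousAt (Metric.isOpen_ball.mem_nhds (by simp))
  set p : (ι → ℝ) → UnitAddTorus ι := Pi.map fun _ t => (t : UnitAddCircle) with hp
  have hpq : IsOpenQuotientMap p :=
    IsOpenQuotientMap.piMap fun _ => QuotientAddGroup.isOpenQuotientMap_mk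
  have hper : ∀ x y, p x = p y → F x = F y := by
    intro x y hxy
    have : ∀ i, ∃ k : ℤ, x i = y i + k := by
      intro i
      have h1 : (x i : UnitAddCircle) = y i := congrFun hxy i
      obtain ⟨k, hk⟩ := (QuotientAddGroup.eq_iff_sub_mem.1 h1)
      refine ⟨k, ?_⟩
      simp at hk
      linarith
    choose k hk using this
    simp only [hF]
    rw [← (Equiv.addLeft k).tsum_eq fun n : ι → ℤ => g (y + fun i => (n i : ℝ))]
    refine tsum_congr fun n => congrArg g (funext fun i => ?_)
    simp [hk, add_assoc]
  set f : C(UnitAddTorus ι, ℂ) :=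
    ⟨fun θ => F (Function.surjInv hpq.surjective θ), by
      rw [← hpq.continuous_comp_iff]
      convert hFc using 1
      ext x
      exact hper _ _ (Function.surjInv_eq hpq.surjective _)⟩ with hf
  have hfp : ∀ x, f (p x) = F x := fun x => hper _ _ (Function.surjInv_eq hpq.surjective _)
  have hexp : ∀ (l : ι → ℤ) (x : ι → ℝ), UnitAddTorus.mFourier l (p x) =
      Complex.exp (2 * Real.pi * Complex.I * ∑ i, (l i : ℂ) * x i) := by
    intro l x
    simp only [UnitAddTorus.mFourier, ContinuousMap.coe_mk, hp, Pi.map_apply, fourier_coe_apply,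
      ← Complex.exp_sum, Finset.mul_sum]
    congr 1
    refine Finset.sum_congr rfl fun i _ => ?_
    simp
    ring
  have hcoeff : ∀ l : ι → ℤ, UnitAddTorus.mFourierCoeff f l =
      ∫ y, Complex.exp (-2 * Real.pi * Complex.I * ∑ i, (l i : ℂ) * y i) * g y := by
    intro l
    rw [UnitAddTorus.mFourierCoeff_eq_integral f l 0]
    set e : (ι → ℝ) → ℂ := fun y => Complex.exp (-2 * Real.pi * Complex.I * ∑ i, (l i : ℂ) * y i)
    have hec : Continuous e := by fun_prop
    have hen : ∀ y, ‖e y‖ = 1 := by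
      intro y
      have : e y = Complex.exp (((-2 * Real.pi * ∑ i, (l i : ℝ) * y i : ℝ) : ℂ) * Complex.I) := by
        simp only [e]
        congr 1
        push_cast
        ring
      rw [this, Complex.norm_exp_ofReal_mul_I]
    have heper : ∀ y (n : ι → ℤ), e (y + fun i => (n i : ℝ)) = e y := by
      intro y n
      simp only [e]
      refine Complex.exp_eq_exp_iff_exists_int.2 ⟨-∑ i, l i * n i, ?_⟩
      simp only [Pi.add_apply, Complex.ofReal_add, mul_add, Finset.sum_add_distrib]
      push_cast
      ring
    have hhi : MeasureTheory.Integrable fun y => e y * g y := by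
      refine hint.norm.mono' (by fun_prop) (Filter.Eventually.of_forall fun y => ?_)
      simp [hen]
    rw [← tsum_setIntegral_cube_add_intCast hhi]
    obtain ⟨u, hu, hbu⟩ := hb 2
    have hfin : MeasureTheory.IsFiniteMeasure ((MeasureTheory.volume : MeasureTheory.Measure
        (ι → ℝ)).restrict {x : ι → ℝ | ∀ i, x i ∈ Set.Ioc (0 : ℝ) (0 + 1)}) := by
      refine ⟨?_⟩
      rw [MeasureTheory.Measure.restrict_apply_univ]
      have : {x : ι → ℝ | ∀ i, x i ∈ Set.Ioc (0 : ℝ) (0 + 1)} =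
        Set.univ.pi fun _ => Set.Ioc (0 : ℝ) (0 + 1) := by ext; simp
      rw [this, MeasureTheory.volume_pi_pi]
      simp
    have hms : MeasurableSet {x : ι → ℝ | ∀ i, x i ∈ Set.Ioc (0 : ℝ) (0 + 1)} :=
      MeasurableSet.univ_pi' fun i => measurableSet_Ioc
    have hbound : ∀ n : ι → ℤ, ∀ᵐ y ∂((MeasureTheory.volume : MeasureTheory.Measure
        (ι → ℝ)).restrict {x : ι → ℝ | ∀ i, x i ∈ Set.Ioc (0 : ℝ) (0 + 1)}),
        ‖e (y + fun i => (n i : ℝ)) * g (y + fun i => (n i : ℝ))‖ ≤ u n := by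
      intro n
      refine (MeasureTheory.ae_restrict_iff' hms).2 (Filter.Eventually.of_forall fun y hy => ?_)
      rw [norm_mul, hen, one_mul]
      refine hbu n y ((pi_norm_lt_iff two_pos).2 fun i => ?_)
      have := hy i
      rw [Real.norm_eq_abs, abs_lt]
      constructor <;> linarith [this.1, this.2]
    have hFi : ∀ n : ι → ℤ, MeasureTheory.Integrable
        (fun y => e (y + fun i => (n i : ℝ)) * g (y + fun i => (n i : ℝ)))
        ((MeasureTheory.volume : MeasureTheory.Measure
        (ι → ℝ)).restrict {x : ι → ℝ | ∀ i, x i ∈ Set.Ioc (0 : ℝ) (0 + 1)}) := fun n =>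
      (MeasureTheory.integrable_const (u n)).mono'
        (Continuous.aestronglyMeasurable (by fun_prop)) (hbound n)
    rw [MeasureTheory.integral_tsum_of_summable_integral_norm hFi]
    · refine MeasureTheory.setIntegral_congr_fun hms fun y _ => ?_
      change UnitAddTorus.mFourier (-l) (p y) • f (p y) = _
      rw [hfp, hexp, smul_eq_mul, ← tsum_mul_left]
      refine tsum_congr fun n => ?_
      rw [heper]
      congr 2
      simp
    · refine Summable.of_nonneg_of_le (fun n => MeasureTheory.integral_nonneg fun _ => norm_nonneg _)
        (fun n => MeasureTheory.integral_mono_ae (hFi n).norm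
          (MeasureTheory.integrable_const (u n)) (hbound n)) ?_
      simp only [MeasureTheory.integral_const]
      exact hu.const_smul _
  have hmain := UnitAddTorus.hasSum_mFourier_series_apply_of_summable (f := f)
    (by rw [funext hcoeff]; exact hc) (p x)
  simpa only [hcoeff, hexp, hfp, smul_eq_mul] using hmain

theorem exists_mul_sum_sq_le_of_inner {ι κ W : Type*} [Fintype ι] [NormedAddCommGroup W]
    [InnerProductSpace ℝ W] (w : κ → W) (x : κ → ι → ℝ) (v : ι → W)
    (h : ∀ k i, inner ℝ (w k) (v i) = x k i) :
    ∃ δ : ℝ, 0 < δ ∧ ∀ k, δ * ∑ i, x k i ^ 2 ≤ ‖w k‖ ^ 2 := by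
  have hpos : 0 < ∑ i, ‖v i‖ ^ 2 + 1 := by positivity
  refine ⟨(∑ i, ‖v i‖ ^ 2 + 1)⁻¹, inv_pos.2 hpos, fun k => ?_⟩
  rw [inv_mul_le_iff₀ hpos]
  have : ∑ i, x k i ^ 2 ≤ ∑ i, ‖v i‖ ^ 2 * ‖w k‖ ^ 2 := by
    refine Finset.sum_le_sum fun i _ => ?_
    rw [← h, ← sq_abs, ← mul_pow, mul_comm ‖v i‖]
    gcongr
    exact abs_real_inner_le_norm _ _
  rw [← Finset.sum_mul] at this
  nlinarith [sq_nonneg ‖w k‖]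

section DualVector

variable {ι W : Type*} [Fintype ι] [NormedAddCommGroup W] [InnerProductSpace ℝ W]
  [FiniteDimensional ℝ W]

/-- The vector whose inner products with the vectors of the basis `b` are the entries of `l`. -/
noncomputable def dualVec (b : Module.Basis ι ℝ W) (l : ι → ℝ) : W :=
  haveI := FiniteDimensional.complete ℝ W
  (InnerProductSpace.toDual ℝ W).symm (LinearMap.toContinuousLinearMap (b.constr ℝ l))

theorem inner_dualVec (b : Module.Basis ι ℝ W) (l : ι → ℝ) (i : ι) :
    inner ℝ (dualVec b l) (b i) = l i := by
  simp [dualVec]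

theorem inner_dualVec_equivFun_symm (b : Module.Basis ι ℝ W) (l x : ι → ℝ) :
    inner ℝ (dualVec b l) (b.equivFun.symm x) = ∑ i, l i * x i := by
  simp [Module.Basis.equivFun_symm_apply, inner_sum, inner_smul_right, inner_dualVec, mul_comm]

theorem eq_dualVec (b : Module.Basis ι ℝ W) {l : ι → ℝ} {y : W}
    (h : ∀ i, inner ℝ y (b i) = l i) : y = dualVec b l :=
  InnerProductSpace.ext_inner_right_basis b fun i => by rw [h, inner_dualVec]

theorem summable_exp_neg_norm_sq_dualVec (b : Module.Basis ι ℝ W) {c : ℝ} (hc : 0 < c) :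
    Summable fun l : ι → ℤ => Real.exp (-c * ‖dualVec b fun i => (l i : ℝ)‖ ^ 2) := by
  obtain ⟨δ, hδ, h⟩ := exists_mul_sum_sq_le_of_inner (dualVec b) (fun l i => l i) b (inner_dualVec b)
  refine Summable.of_nonneg_of_le (fun _ => (Real.exp_pos _).le) (fun l => ?_)
    (summable_exp_neg_mul_sum_sq (ι := ι) (mul_pos hc hδ))
  refine Real.exp_le_exp.2 ?_
  nlinarith [h fun i => (l i : ℝ)]

theorem exists_summable_gaussian_bound (b : Module.Basis ι ℝ W) (r : ℝ) :
    ∃ u : (ι → ℤ) → ℝ, Summable u ∧ ∀ (n : ι → ℤ) (x : ι → ℝ), ‖x‖ < r →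
      Real.exp (-Real.pi * ‖b.equivFun.symm (x + fun i => (n i : ℝ))‖ ^ 2) ≤ u n := by
  obtain ⟨δ, hδ, h⟩ := exists_mul_sum_sq_le_of_inner b.equivFun.symm (fun x i => x i)
    (fun i => dualVec b (Pi.single i 1)) fun x i => by
      rw [real_inner_comm, inner_dualVec_equivFun_symm]
      simp [Pi.single_apply]
  refine ⟨fun n => Real.exp (Real.pi * δ * (Fintype.card ι * r ^ 2)) *
    Real.exp (-(Real.pi * δ / 2) * ∑ i, (n i : ℝ) ^ 2),
    (summable_exp_neg_mul_sum_sq (by positivity)).mul_left _, fun n x hx => ?_⟩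
  beta_reduce
  rw [← Real.exp_add, Real.exp_le_exp]
  have h1 := h (x + fun i => (n i : ℝ))
  have h2 : ∑ i, (n i : ℝ) ^ 2 / 2 - ∑ _i : ι, r ^ 2 ≤ ∑ i, (x + fun i => (n i : ℝ)) i ^ 2 := by
    rw [← Finset.sum_sub_distrib]
    refine Finset.sum_le_sum fun i _ => ?_
    have h3 : |x i| ≤ r := (norm_le_pi_norm x i).trans hx.le
    have h4 : x i ^ 2 ≤ r ^ 2 := sq_le_sq' (abs_le.1 h3).1 (abs_le.1 h3).2
    simp only [Pi.add_apply]
    nlinarith [sq_nonneg (2 * x i + n i)]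
  simp only [Finset.sum_const, Finset.card_univ, nsmul_eq_mul, ← Finset.sum_div] at h2
  have h5 := mul_le_mul_of_nonneg_left h2 hδ.le
  have h6 := mul_le_mul_of_nonneg_left (h5.trans h1) Real.pi_pos.le
  linarith

theorem summable_gaussian (b : Module.Basis ι ℝ W) (x : ι → ℝ) :
    Summable fun n : ι → ℤ =>
      Real.exp (-Real.pi * ‖b.equivFun.symm (x + fun i => (n i : ℝ))‖ ^ 2) := by
  obtain ⟨u, hu, h⟩ := exists_summable_gaussian_bound b (‖x‖ + 1)
  exact Summable.of_nonneg_of_le (fun _ => (Real.exp_pos _).le)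
    (fun n => h n x (lt_add_one _)) hu

theorem exists_integral_exp_mul_gaussian (b : Module.Basis ι ℝ W) :
    ∃ K : ℝ, 0 < K ∧
      MeasureTheory.Integrable
        (fun x : ι → ℝ => ((Real.exp (-Real.pi * ‖b.equivFun.symm x‖ ^ 2) : ℝ) : ℂ)) ∧
      ∀ l : ι → ℝ, ∫ y : ι → ℝ, Complex.exp (-2 * Real.pi * Complex.I * ∑ i, (l i : ℂ) * y i) *
        ((Real.exp (-Real.pi * ‖b.equivFun.symm y‖ ^ 2) : ℝ) : ℂ) =
      ((K * Real.exp (-Real.pi * ‖dualVec b l‖ ^ 2) : ℝ) : ℂ) := by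
  borelize W
  set L : (ι → ℝ) ≃L[ℝ] W := b.equivFun.symm.toContinuousLinearEquiv
  set μ : MeasureTheory.Measure W := MeasureTheory.Measure.map L MeasureTheory.volume
  obtain ⟨κ, hκ, hμ⟩ : ∃ κ : NNReal, 0 < κ ∧
      μ = κ • (MeasureTheory.volume : MeasureTheory.Measure W) :=
    ⟨_, MeasureTheory.Measure.addHaarScalarFactor_pos_of_isAddHaarMeasure _ _,
      MeasureTheory.Measure.isAddLeftInvariant_eq_smul _ _⟩
  have hemb : MeasurableEmbedding L := L.toHomeomorph.measurableEmbedding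
  have hpi : 0 < (Real.pi : ℂ).re := by simpa using Real.pi_pos
  refine ⟨_, NNReal.coe_pos.2 hκ, ?_, fun l => ?_⟩
  · have h := GaussianFourier.integrable_cexp_neg_mul_sq_norm_add hpi 0 (0 : W)
    have h2 : MeasureTheory.Integrable
        (fun v : W => Complex.exp (-Real.pi * ‖v‖ ^ 2 + 0 * (inner ℝ (0 : W) v : ℝ))) μ := by
      rw [hμ]
      exact h.smul_measure_nnreal
    rw [hemb.integrable_map_iff] at h2
    convert h2 using 2 with x
    simp [L]
  · have h := GaussianFourier.integral_cexp_neg_mul_sq_norm_add hpi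
      (-2 * Real.pi * Complex.I) (dualVec b l)
    have h2 : ∫ v, Complex.exp (-Real.pi * ‖v‖ ^ 2 +
        (-2 * Real.pi * Complex.I) * (inner ℝ (dualVec b l) v : ℝ)) ∂μ =
        ∫ y : ι → ℝ, Complex.exp (-2 * Real.pi * Complex.I * ∑ i, (l i : ℂ) * y i) *
        ((Real.exp (-Real.pi * ‖b.equivFun.symm y‖ ^ 2) : ℝ) : ℂ) := by
      rw [hemb.integral_map]
      congr 1
      ext y
      change Complex.exp (-Real.pi * ‖b.equivFun.symm y‖ ^ 2 + (-2 * Real.pi * Complex.I) *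
        (inner ℝ (dualVec b l) (b.equivFun.symm y) : ℝ)) = _
      rw [inner_dualVec_equivFun_symm, Complex.ofReal_exp, ← Complex.exp_add]
      push_cast
      ring_nf
    rw [← h2, hμ, MeasureTheory.integral_smul_nnreal_measure, h]
    have hpi' : (Real.pi : ℂ) ≠ 0 := by simp [Real.pi_ne_zero]
    rw [div_self hpi', Complex.one_cpow, one_mul, NNReal.smul_def, Complex.real_smul,
      Complex.ofReal_mul, Complex.ofReal_exp]
    congr 2
    push_cast
    field_simp
    rw [Complex.I_sq]
    ring

/-- Integer translates of a Gaussian sum to a nearly constant function if the Gaussian mass of the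
nonzero dual lattice vectors is small. -/
theorem exists_abs_tsum_gaussian_sub_le (b : Module.Basis ι ℝ W) :
    ∃ K : ℝ, 0 < K ∧ ∀ x : ι → ℝ,
      |∑' n : ι → ℤ, Real.exp (-Real.pi * ‖b.equivFun.symm (x + fun i => (n i : ℝ))‖ ^ 2) - K| ≤
      K * ∑' l : ι → ℤ, if l = 0 then 0 else
        Real.exp (-Real.pi * ‖dualVec b fun i => (l i : ℝ)‖ ^ 2) := by
  obtain ⟨K, hK, hint, hcoeff⟩ := exists_integral_exp_mul_gaussian b
  refine ⟨K, hK, fun x => ?_⟩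
  have hs := summable_exp_neg_norm_sq_dualVec b Real.pi_pos
  have hcont : Continuous (b.equivFun.symm : (ι → ℝ) → W) :=
    LinearMap.continuous_of_finiteDimensional b.equivFun.symm.toLinearMap
  have hP := hasSum_fourier_of_periodization
    (g := fun x => ((Real.exp (-Real.pi * ‖b.equivFun.symm x‖ ^ 2) : ℝ) : ℂ))
    (by fun_prop) hint
    (fun r => by
      obtain ⟨u, hu, h⟩ := exists_summable_gaussian_bound b r
      refine ⟨u, hu, fun n x hx => ?_⟩
      rw [Complex.norm_real, Real.norm_of_nonneg (Real.exp_pos _).le]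
      exact h n x hx)
    (by
      have h := Complex.summable_ofReal.2 (hs.mul_left K)
      refine h.congr fun l => ?_
      exact_mod_cast (hcoeff fun i => (l i : ℝ)).symm) x
  have hcoeff' : ∀ l : ι → ℤ, _ := fun l => hcoeff fun i => (l i : ℝ)
  simp only [Complex.ofReal_intCast] at hcoeff'
  simp only [hcoeff', ← Complex.ofReal_tsum] at hP
  have h0 := hP.summable.tsum_eq_add_tsum_ite 0
  rw [hP.tsum_eq] at h0
  have hd0 : dualVec b (fun _ => 0) = 0 := (eq_dualVec b fun i => by simp).symm
  simp only [Pi.zero_apply, Int.cast_zero, hd0, norm_zero, zero_mul, Finset.sum_const_zero,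
    mul_zero, Complex.exp_zero, mul_one, ne_eq, OfNat.ofNat_ne_zero, not_false_eq_true,
    zero_pow, Real.exp_zero] at h0
  rw [← Real.norm_eq_abs, ← Complex.norm_real, Complex.ofReal_sub, h0, add_sub_cancel_left,
    ← tsum_mul_left]
  have hs' : Summable fun l : ι → ℤ => K * if l = 0 then 0 else
      Real.exp (-Real.pi * ‖dualVec b fun i => (l i : ℝ)‖ ^ 2) := by
    refine Summable.mul_left _ (hs.of_nonneg_of_le (fun l => ?_) fun l => ?_)
    · split_ifs <;> positivity
    · split_ifs
      · positivity
      · rfl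
  refine tsum_of_norm_bounded hs'.hasSum fun l => ?_
  split_ifs with hl
  · simp
  · have : Complex.exp (2 * Real.pi * Complex.I * ∑ i, (l i : ℂ) * x i) =
        Complex.exp (((2 * Real.pi * ∑ i, (l i : ℝ) * x i : ℝ) : ℂ) * Complex.I) := by
      congr 1
      push_cast
      ring
    rw [norm_mul, this, Complex.norm_exp_ofReal_mul_I, Complex.norm_real, mul_one,
      Real.norm_of_nonneg (by positivity)]

end DualVector

theorem exists_intCast_eq_smul {m : ℕ} (q : Fin m → ℚ) :
    ∃ N : ℤ, N ≠ 0 ∧ ∃ v : Fin m → ℤ, ∀ j, (v j : ℚ) = N * q j := by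
  obtain ⟨N, hN⟩ := IsLocalization.exist_integer_multiples_of_finite (nonZeroDivisors ℤ) q
  choose v hv using hN
  exact ⟨N, nonZeroDivisors.coe_ne_zero N, v, fun j => by simpa [zsmul_eq_mul] using hv j⟩

/-- The real kernel of an integer matrix is spanned by its integer kernel. -/
theorem mem_span_intCast_ker_of_mulVec_eq_zero {n m : ℕ} (X : Matrix (Fin n) (Fin m) ℤ)
    {x : Fin m → ℝ} (hx : X.map (Int.cast : ℤ → ℝ) *ᵥ x = 0) :
    x ∈ Submodule.span ℝ {y | ∃ v : Fin m → ℤ, X *ᵥ v = 0 ∧ y = intCast' v} := by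
  set B := Module.Basis.ofVectorSpace ℚ ℝ
  set S := Finset.univ.biUnion fun j => (B.repr (x j)).support with hS
  have hsum : x = ∑ s ∈ S, B s • fun j => (B.coord s (x j) : ℝ) := by
    ext j
    have h := B.linearCombination_repr (x j)
    rw [Finsupp.linearCombination_apply, Finsupp.sum_of_support_subset (s := S)] at h
    · rw [Finset.sum_apply]
      conv_lhs => rw [← h]
      refine Finset.sum_congr rfl fun s _ => ?_
      simp [Rat.smul_def, mul_comm]
    · exact Finset.subset_biUnion_of_mem (fun j => (B.repr (x j)).support) (Finset.mem_univ j)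
    · simp
  rw [hsum]
  refine Submodule.sum_mem _ fun s _ => Submodule.smul_mem _ _ ?_
  obtain ⟨N, hN, v, hv⟩ := exists_intCast_eq_smul fun j => B.coord s (x j)
  have hXv : X *ᵥ v = 0 := by
    ext i
    have h1 : ((X *ᵥ v) i : ℚ) = N * B.coord s ((X.map (Int.cast : ℤ → ℝ) *ᵥ x) i) := by
      simp only [Matrix.mulVec, dotProduct, map_sum, Int.cast_sum, Int.cast_mul, hv,
        Finset.mul_sum, Matrix.map_apply]
      refine Finset.sum_congr rfl fun j _ => ?_
      rw [← zsmul_eq_mul (x j), map_zsmul, zsmul_eq_mul]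
      ring
    rw [hx] at h1
    simpa using h1
  have hq : (fun j => (B.coord s (x j) : ℝ)) = (N : ℝ)⁻¹ • intCast' v := by
    ext j
    have h1 : (v j : ℝ) = N * (B.coord s (x j) : ℝ) := by exact_mod_cast hv j
    simp only [Pi.smul_apply, intCast', h1, smul_eq_mul]
    field_simp
  rw [hq]
  exact Submodule.smul_mem _ _ (Submodule.subset_span ⟨v, hXv, rfl⟩)

theorem exists_basis_mem_iff_of_span_eq {E : Type*} [NormedAddCommGroup E] [NormedSpace ℝ E]
    [FiniteDimensional ℝ E] (Λ : Submodule ℤ E) [DiscreteTopology Λ] (V : Submodule ℝ E)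
    (hV : V = Submodule.span ℝ (Λ : Set E)) :
    ∃ (k : ℕ) (b : Module.Basis (Fin k) ℝ V), ∀ x : E,
      x ∈ Λ ↔ ∃ l : Fin k → ℤ, (b.equivFun.symm (fun i => (l i : ℝ)) : E) = x := by
  subst hV
  set V := Submodule.span ℝ (Λ : Set E)
  let L : Submodule ℤ V := Λ.comap (V.restrictScalars ℤ).subtype
  let f := Submodule.comapSubtypeEquivOfLe
    (show Λ ≤ V.restrictScalars ℤ from Submodule.subset_span)
  have : DiscreteTopology L := by
    let e : Λ ≃L[ℤ] L :=
      ⟨f.symm, continuous_of_discreteTopology, Isometry.continuous fun _ ↦ congrFun rfl⟩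
    exact e.toHomeomorph.discreteTopology
  have : IsZLattice ℝ L := ⟨eq_top_iff.mpr Submodule.span_span_coe_preimage.symm.le⟩
  have := ZLattice.module_finite ℝ L
  have := ZLattice.module_free ℝ L
  let bL := Module.finBasis ℤ L
  refine ⟨_, bL.ofZLatticeBasis ℝ L, fun x => ?_⟩
  have key (l : Fin (Module.finrank ℤ L) → ℤ) :
      ((bL.ofZLatticeBasis ℝ L).equivFun.symm (fun i => (l i : ℝ)) : V) = bL.equivFun.symm l := by
    simp [Module.Basis.equivFun_symm_apply, Int.cast_smul_eq_zsmul]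
  constructor
  · intro hx
    refine ⟨bL.equivFun ⟨⟨x, Submodule.subset_span hx⟩, hx⟩, ?_⟩
    rw [key, LinearEquiv.symm_apply_apply]
  · rintro ⟨l, rfl⟩
    rw [key]
    exact (bL.equivFun.symm l).2

/-- The real span of the integer kernel of `X`, as a subspace of Euclidean space. -/
noncomputable def intKerSpan {n m : ℕ} (X : Matrix (Fin n) (Fin m) ℤ) :
    Submodule ℝ (EuclideanSpace ℝ (Fin m)) :=
  (Submodule.span ℝ {y | ∃ v : Fin m → ℤ, X *ᵥ v = 0 ∧ y = intCast' v}).comap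
    (WithLp.linearEquiv 2 ℝ (Fin m → ℝ)).toLinearMap

theorem mulVec_eq_zero_of_mem_intKerSpan {n m : ℕ} (X : Matrix (Fin n) (Fin m) ℤ)
    {x : EuclideanSpace ℝ (Fin m)} (hx : x ∈ intKerSpan X) :
    X.map (Int.cast : ℤ → ℝ) *ᵥ x.ofLp = 0 := by
  have : Submodule.span ℝ {y | ∃ v : Fin m → ℤ, X *ᵥ v = 0 ∧ y = intCast' v} ≤
      LinearMap.ker (X.map (Int.cast : ℤ → ℝ)).mulVecLin := by
    rw [Submodule.span_le]
    rintro _ ⟨v, hv, rfl⟩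
    rw [SetLike.mem_coe, LinearMap.mem_ker, Matrix.mulVecLin_apply]
    ext i
    have := congrArg (Int.cast : ℤ → ℝ) (congrFun hv i)
    simpa [Matrix.mulVec, dotProduct, intCast'] using this
  exact this hx

theorem mem_intKerSpan_iff {n m : ℕ} (X : Matrix (Fin n) (Fin m) ℤ)
    (x : EuclideanSpace ℝ (Fin m)) :
    x ∈ intKerSpan X ↔ X.map (Int.cast : ℤ → ℝ) *ᵥ x.ofLp = 0 :=
  ⟨mulVec_eq_zero_of_mem_intKerSpan X, fun h => mem_span_intCast_ker_of_mulVec_eq_zero X h⟩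

/-- The integer vector `v` as a point of Euclidean space. -/
def intCastLp (m : ℕ) : (Fin m → ℤ) →ₗ[ℤ] EuclideanSpace ℝ (Fin m) where
  toFun v := WithLp.toLp 2 (intCast' v)
  map_add' v w := by ext; simp [intCast']
  map_smul' a v := by ext; simp [intCast']

theorem exists_basis_intKerSpan {n m : ℕ} (X : Matrix (Fin n) (Fin m) ℤ) :
    ∃ (k : ℕ) (b : Module.Basis (Fin k) ℝ (intKerSpan X)) (A : (Fin k → ℤ) → Fin m → ℤ),
      (∀ l, X *ᵥ A l = 0) ∧ (∀ v, X *ᵥ v = 0 → ∃ l, A l = v) ∧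
      ∀ l, (b.equivFun.symm (fun i => (l i : ℝ)) : EuclideanSpace ℝ (Fin m)) =
        WithLp.toLp 2 (intCast' (A l)) := by
  let Λ := (LinearMap.ker X.mulVecLin).map (intCastLp m)
  have hΛ (x) : x ∈ Λ ↔ ∃ v, X *ᵥ v = 0 ∧ WithLp.toLp 2 (intCast' v) = x := by
    simp [Λ, intCastLp]
  have hle : Λ ≤ Submodule.span ℤ
      (Set.range (EuclideanSpace.basisFun (Fin m) ℝ).toBasis) := by
    intro x hx
    obtain ⟨v, -, rfl⟩ := (hΛ x).1 hx
    rw [Module.Basis.mem_span_iff_repr_mem]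
    exact fun i => ⟨v i, by simp [intCast']⟩
  have : DiscreteTopology Λ := DiscreteTopology.of_subset
    (inferInstanceAs (DiscreteTopology (Submodule.span ℤ
      (Set.range (EuclideanSpace.basisFun (Fin m) ℝ).toBasis)))) hle
  have hV : intKerSpan X = Submodule.span ℝ (Λ : Set (EuclideanSpace ℝ (Fin m))) := by
    rw [intKerSpan, Submodule.comap_equiv_eq_map_symm, Submodule.map_span]
    congr 1
    ext x
    simp only [SetLike.mem_coe, hΛ]
    constructor
    · rintro ⟨_, ⟨v, hv, rfl⟩, rfl⟩
      exact ⟨v, hv, rfl⟩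
    · rintro ⟨v, hv, rfl⟩
      exact ⟨_, ⟨v, hv, rfl⟩, rfl⟩
  obtain ⟨k, b, hb⟩ := exists_basis_mem_iff_of_span_eq Λ _ hV
  have h1 (l : Fin k → ℤ) := (hΛ _).1 ((hb _).2 ⟨l, rfl⟩)
  choose A hA hAl using h1
  refine ⟨k, b, A, hA, fun v hv => ?_, fun l => (hAl l).symm⟩
  obtain ⟨l, hl⟩ := (hb _).1 ((hΛ _).2 ⟨v, hv, rfl⟩)
  refine ⟨l, ?_⟩
  have h2 := WithLp.toLp_injective 2 ((hAl l).trans hl)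
  ext i
  exact Int.cast_injective (α := ℝ) (congrFun h2 i)

theorem mul_norm_dualVec_le_norm_dualVec_map {ι V W : Type*} [Fintype ι]
    [NormedAddCommGroup V] [InnerProductSpace ℝ V] [FiniteDimensional ℝ V]
    [NormedAddCommGroup W] [InnerProductSpace ℝ W] [FiniteDimensional ℝ W]
    (b : Module.Basis ι ℝ V) (e : V ≃ₗ[ℝ] W) {σ : ℝ} (hσ : 0 < σ) (he : ∀ y, σ * ‖e y‖ ≤ ‖y‖)
    (l : ι → ℝ) : σ * ‖dualVec b l‖ ≤ ‖dualVec (b.map e) l‖ := by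
  set y := dualVec b l with hy
  have h1 : inner ℝ (dualVec (b.map e) l) (e y) = ‖y‖ ^ 2 := by
    have h2 : e y = (b.map e).equivFun.symm (b.equivFun y) := by
      rw [LinearEquiv.eq_symm_apply]
      ext i
      simp
    rw [h2, inner_dualVec_equivFun_symm, ← inner_dualVec_equivFun_symm b, ← hy,
      LinearEquiv.symm_apply_apply, real_inner_self_eq_norm_sq]
  have h3 := real_inner_le_norm (dualVec (b.map e) l) (e y)
  rw [h1] at h3
  rcases (norm_nonneg y).eq_or_lt with h0 | h0
  · rw [← h0, mul_zero]
    exact norm_nonneg _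
  · refine le_of_mul_le_mul_right ?_ h0
    calc σ * ‖y‖ * ‖y‖ = σ * ‖y‖ ^ 2 := by ring
      _ ≤ σ * (‖dualVec (b.map e) l‖ * ‖e y‖) := by gcongr
      _ = ‖dualVec (b.map e) l‖ * (σ * ‖e y‖) := by ring
      _ ≤ ‖dualVec (b.map e) l‖ * ‖y‖ := by gcongr; exact he y

/-- The map `x ↦ (Rᵀ)⁻¹ x` on Euclidean space. -/
noncomputable def transposeInvEquiv {m : ℕ} (R : Matrix (Fin m) (Fin m) ℝ) (hR : IsUnit R.det) :
    EuclideanSpace ℝ (Fin m) ≃ₗ[ℝ] EuclideanSpace ℝ (Fin m) where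
  toFun x := WithLp.toLp 2 (Rᵀ⁻¹ *ᵥ x.ofLp)
  map_add' x y := by simp [Matrix.mulVec_add]
  map_smul' a x := by simp [Matrix.mulVec_smul]
  invFun x := WithLp.toLp 2 (Rᵀ *ᵥ x.ofLp)
  left_inv x := by
    simp [Matrix.mulVec_mulVec, Matrix.mul_nonsing_inv Rᵀ (by rwa [Matrix.det_transpose])]
  right_inv x := by
    simp [Matrix.mulVec_mulVec, Matrix.nonsing_inv_mul Rᵀ (by rwa [Matrix.det_transpose])]

theorem rho_eq_exp_norm_sq {m : ℕ} (R : Matrix (Fin m) (Fin m) ℝ) (hR : IsUnit R.det)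
    (x : EuclideanSpace ℝ (Fin m)) :
    rho R x.ofLp = Real.exp (-Real.pi * ‖transposeInvEquiv R hR x‖ ^ 2) := by
  rw [rho, ← real_inner_self_eq_norm_sq, EuclideanSpace.inner_eq_star_dotProduct]
  simp only [transposeInvEquiv, LinearEquiv.coe_mk, LinearMap.coe_mk, AddHom.coe_mk, star_trivial]
  rw [Matrix.mul_inv_rev, ← Matrix.mulVec_mulVec, Matrix.dotProduct_mulVec,
    ← Matrix.mulVec_transpose, Matrix.transpose_nonsing_inv]

theorem enorm'_eq_norm {k : ℕ} (x : Fin k → ℝ) : enorm' x = ‖WithLp.toLp 2 x‖ := by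
  simp [enorm', EuclideanSpace.norm_eq]

theorem mul_norm_transposeInvEquiv_le {m : ℕ} {R : Matrix (Fin m) (Fin m) ℝ} (hR : IsUnit R.det)
    {σ : ℝ} (hσ : 0 < σ) (h : ∀ x : Fin m → ℝ, σ * enorm' x ≤ enorm' (R *ᵥ x))
    (y : EuclideanSpace ℝ (Fin m)) : σ * ‖transposeInvEquiv R hR y‖ ≤ ‖y‖ := by
  set z := transposeInvEquiv R hR y with hz
  have hy : y = WithLp.toLp 2 (Rᵀ *ᵥ z.ofLp) := ((transposeInvEquiv R hR).symm_apply_apply y).symm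
  set x := R⁻¹ *ᵥ z.ofLp with hx
  have hRx : R *ᵥ x = z.ofLp := by rw [hx, Matrix.mulVec_mulVec, Matrix.mul_nonsing_inv R hR,
    Matrix.one_mulVec]
  have h1 : σ * ‖WithLp.toLp 2 x‖ ≤ ‖z‖ := by
    have := h x
    rwa [enorm'_eq_norm, enorm'_eq_norm, hRx] at this
  have h2 : ‖z‖ ^ 2 = inner ℝ (WithLp.toLp 2 x) y := by
    rw [← real_inner_self_eq_norm_sq, EuclideanSpace.inner_eq_star_dotProduct,
      EuclideanSpace.inner_eq_star_dotProduct, hy]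
    simp only [star_trivial]
    rw [Matrix.mulVec_transpose, ← Matrix.dotProduct_mulVec, hRx]
  have h3 := real_inner_le_norm (WithLp.toLp 2 x) y
  rw [← h2] at h3
  rcases (norm_nonneg z).eq_or_lt with h0 | h0
  · rw [← h0, mul_zero]
    exact norm_nonneg _
  · refine le_of_mul_le_mul_right ?_ h0
    calc σ * ‖z‖ * ‖z‖ = σ * ‖z‖ ^ 2 := by ring
      _ ≤ σ * (‖WithLp.toLp 2 x‖ * ‖y‖) := by gcongr
      _ = σ * ‖WithLp.toLp 2 x‖ * ‖y‖ := by ring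
      _ ≤ ‖z‖ * ‖y‖ := by gcongr
      _ = ‖y‖ * ‖z‖ := mul_comm _ _

/-- The dual lattice of the integer kernel, written in coordinates dual to a lattice basis. -/
theorem tsum_dualVec_intKerSpan {n m k : ℕ} (X : Matrix (Fin n) (Fin m) ℤ)
    (b : Module.Basis (Fin k) ℝ (intKerSpan X)) (A : (Fin k → ℤ) → Fin m → ℤ)
    (hA : ∀ l, X *ᵥ A l = 0) (hA' : ∀ v, X *ᵥ v = 0 → ∃ l, A l = v)
    (hbA : ∀ l, (b.equivFun.symm (fun i => (l i : ℝ)) : EuclideanSpace ℝ (Fin m)) =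
        WithLp.toLp 2 (intCast' (A l))) (Acast : Set (Fin m → ℝ))
    (hAcast : Acast = {y | ∃ v : Fin m → ℤ, X *ᵥ v = 0 ∧ y = intCast' v})
    (Adual : Set (Fin m → ℝ))
    (hAdual : Adual = {y | y ∈ Submodule.span ℝ Acast ∧
        ∀ a ∈ Acast, ∃ k : ℤ, ∑ i, y i * a i = (k : ℝ)}) (f : ℝ → ℝ) :
    ∑' l : Fin k → ℤ, (if l = 0 then 0 else f (‖dualVec b fun i => (l i : ℝ)‖ ^ 2)) =
      ∑' y : {y : Fin m → ℝ // y ∈ Adual ∧ y ≠ 0}, f (∑ i, (y.1 i) ^ 2) := by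
  let g (l : Fin k → ℤ) : intKerSpan X := dualVec b fun i => (l i : ℝ)
  have hinner (y : intKerSpan X) (l : Fin k → ℤ) :
      inner ℝ y (b.equivFun.symm (fun i => (l i : ℝ))) =
        ∑ i, (y : EuclideanSpace ℝ (Fin m)).ofLp i * intCast' (A l) i := by
    rw [Submodule.coe_inner, hbA, PiLp.inner_apply]
    simp [mul_comm]
  have hginj : Function.Injective g := by
    intro l l' h
    ext i
    have := inner_dualVec b (fun i => (l i : ℝ)) i
    rw [show (dualVec b fun i => (l i : ℝ)) = dualVec b fun i => (l' i : ℝ) from h,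
      inner_dualVec] at this
    exact_mod_cast this.symm
  have hg0 : g 0 = 0 := (eq_dualVec b fun i => by simp).symm
  have hgmem (l) : (g l : EuclideanSpace ℝ (Fin m)).ofLp ∈ Adual := by
    subst hAdual hAcast
    refine ⟨(g l).2, ?_⟩
    rintro _ ⟨v, hv, rfl⟩
    obtain ⟨l', rfl⟩ := hA' v hv
    rw [← hinner, inner_dualVec_equivFun_symm]
    exact ⟨∑ i, l i * l' i, by push_cast; rfl⟩
  have hgsurj (y) (hy : y ∈ Adual) : ∃ l, (g l : EuclideanSpace ℝ (Fin m)).ofLp = y := by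
    subst hAdual hAcast
    obtain ⟨hy1, hy2⟩ := hy
    choose l hl using fun i => hy2 _ ⟨A (Pi.single i 1), hA _, rfl⟩
    let y' : intKerSpan X := ⟨WithLp.toLp 2 y, hy1⟩
    have : y' = g l := by
      refine eq_dualVec b fun i => ?_
      rw [← hl, ← hinner y']
      congr 1
      simp [Module.Basis.equivFun_symm_apply, Pi.single_apply]
    exact ⟨l, by rw [← this]⟩
  let e : {l : Fin k → ℤ // l ≠ 0} → {y : Fin m → ℝ // y ∈ Adual ∧ y ≠ 0} := fun l =>
    ⟨(g l.1 : EuclideanSpace ℝ (Fin m)).ofLp, hgmem _, fun h => l.2 <| hginj <| by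
      rw [hg0]
      exact Subtype.ext (WithLp.ofLp_injective 2 h)⟩
  have he : Function.Bijective e := by
    constructor
    · intro l l' h
      have h1 := congrArg Subtype.val h
      exact Subtype.ext (hginj (Subtype.ext (WithLp.ofLp_injective 2 h1)))
    · rintro ⟨y, hy, hy0⟩
      obtain ⟨l, rfl⟩ := hgsurj y hy
      refine ⟨⟨l, ?_⟩, rfl⟩
      rintro rfl
      exact hy0 (by rw [hg0]; rfl)
  rw [← (Equiv.ofBijective e he).tsum_eq]
  have h1 := tsum_subtype {l : Fin k → ℤ | l ≠ 0} fun l => f (‖g l‖ ^ 2)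
  have h2 (l) : ∑ i, ((Equiv.ofBijective e he l).1 i) ^ 2 = ‖g l.1‖ ^ 2 := by
    rw [Submodule.coe_norm, EuclideanSpace.norm_sq_eq]
    simp [e]
  simp_rw [h2]
  refine Eq.trans (tsum_congr fun l => ?_) h1.symm
  by_cases hl : l = 0 <;> simp [hl, g]

/-- A pointwise relative error of at most `ε` before normalization becomes a statistical distance
of at most `2 * ε`. -/
theorem half_tsum_abs_div_sub_div_le {α : Type*} {N r : α → ℝ} {K ε : ℝ} (hK : 0 < K)
    (hε0 : 0 < ε) (hε : ε < 1 / 3) (hr : ∀ a, 0 ≤ r a)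
    (hNr : ∀ a, |N a - K * r a| ≤ K * ε * r a) {D : ℝ} (hN : HasSum N D) (hpos : ∃ a, 0 < r a) :
    1 / 2 * ∑' a, |N a / D - r a / ∑' a, r a| ≤ 2 * ε := by
  have hlow (a) : K * (1 - ε) * r a ≤ N a := by linarith [(abs_le.1 (hNr a)).1]
  have hc : 0 < K * (1 - ε) := mul_pos hK (by linarith)
  have hrs : Summable r := by
    have := Summable.of_nonneg_of_le (fun a => mul_nonneg hc.le (hr a)) hlow hN.summable
    exact (summable_mul_left_iff hc.ne').1 this
  obtain ⟨a₀, ha₀⟩ := hpos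
  set Q := ∑' a, r a with hQdef
  have hQ : 0 < Q := hrs.tsum_pos hr a₀ ha₀
  have hDQ : K * (1 - ε) * Q ≤ D := hasSum_le hlow (hrs.hasSum.mul_left _) hN
  have hD : 0 < D := lt_of_lt_of_le (mul_pos hc hQ) hDQ
  have habs : |K * Q - D| ≤ K * ε * Q := by
    have h1 : HasSum (fun a => N a - K * r a) (D - K * Q) := hN.sub (hrs.hasSum.mul_left K)
    have h2 : HasSum (fun a => K * ε * r a) (K * ε * Q) := hrs.hasSum.mul_left _
    rw [abs_sub_comm, abs_le]
    exact ⟨hasSum_le (fun a => (abs_le.1 (hNr a)).1) h2.neg h1,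
      hasSum_le (fun a => (abs_le.1 (hNr a)).2) h1 h2⟩
  have hpt (a) : |N a / D - r a / Q| ≤ 2 * K * ε / D * r a := by
    have h1 : N a / D - r a / Q = (N a - K * r a) / D + r a / Q * (K * Q - D) / D := by
      field_simp
      ring
    rw [h1]
    refine (abs_add_le _ _).trans ?_
    rw [abs_div, abs_div, abs_mul, abs_div, abs_of_pos hD, abs_of_pos hQ, abs_of_nonneg (hr a)]
    have h2 : r a / Q * |K * Q - D| ≤ r a / Q * (K * ε * Q) :=
      mul_le_mul_of_nonneg_left habs (div_nonneg (hr a) hQ.le)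
    have h3 : r a / Q * (K * ε * Q) = K * ε * r a := by field_simp
    calc _ ≤ K * ε * r a / D + K * ε * r a / D := by
          exact add_le_add (div_le_div_of_nonneg_right (hNr a) hD.le)
            (div_le_div_of_nonneg_right (h2.trans_eq h3) hD.le)
      _ = 2 * K * ε / D * r a := by ring
  have hs2 : HasSum (fun a => 2 * K * ε / D * r a) (2 * K * ε / D * Q) := hrs.hasSum.mul_left _
  have hs1 : Summable fun a => |N a / D - r a / Q| :=
    Summable.of_nonneg_of_le (fun _ => abs_nonneg _) hpt hs2.summable
  have h4 := hasSum_le hpt hs1.hasSum hs2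
  have h5 : 2 * K * ε / D * Q ≤ 4 * ε := by
    rw [div_mul_eq_mul_div, div_le_iff₀ hD]
    have : 0 < K * Q := mul_pos hK hQ
    nlinarith [mul_le_mul_of_nonneg_left hDQ (by linarith : (0 : ℝ) ≤ 4 * ε),
      mul_pos hε0 this, mul_pos this (by linarith : 0 < 1 - 3 * ε),
      mul_pos (mul_pos hε0 this) (by linarith : 0 < 1 - 3 * ε)]
  linarith

theorem isUnit_det_transpose_mul_self {n m : ℕ} {S : Matrix (Fin m) (Fin n) ℝ}
    (hS : Function.Injective S.mulVec) : IsUnit (Sᵀ * S).det := by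
  have := (Matrix.PosDef.conjTranspose_mul_self S hS).isUnit
  rwa [Matrix.conjTranspose_eq_transpose_of_trivial, Matrix.isUnit_iff_isUnit_det] at this

theorem rho_add_of_mulVec_eq_zero {n m : ℕ} {R : Matrix (Fin m) (Fin m) ℝ} (hR : IsUnit R.det)
    {Y : Matrix (Fin n) (Fin m) ℝ} (hM : IsUnit ((R * Yᵀ)ᵀ * (R * Yᵀ)).det) (z : Fin n → ℝ)
    {s : EuclideanSpace ℝ (Fin m)} (hs : Y *ᵥ s.ofLp = 0) :
    rho R (Rᵀ *ᵥ ((R * Yᵀ) *ᵥ (((R * Yᵀ)ᵀ * (R * Yᵀ))⁻¹ *ᵥ z)) + s.ofLp) =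
      rho (R * Yᵀ) z * Real.exp (-Real.pi * ‖transposeInvEquiv R hR s‖ ^ 2) := by
  set g := ((R * Yᵀ)ᵀ * (R * Yᵀ))⁻¹ *ᵥ z with hg
  have hMg : (R * Yᵀ)ᵀ *ᵥ ((R * Yᵀ) *ᵥ g) = z := by
    rw [hg, Matrix.mulVec_mulVec, Matrix.mulVec_mulVec, Matrix.mul_nonsing_inv _ hM,
      Matrix.one_mulVec]
  set p : EuclideanSpace ℝ (Fin m) := WithLp.toLp 2 (Rᵀ *ᵥ ((R * Yᵀ) *ᵥ g)) with hp
  have hTp : transposeInvEquiv R hR p = WithLp.toLp 2 ((R * Yᵀ) *ᵥ g) :=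
    (transposeInvEquiv R hR).apply_symm_apply (WithLp.toLp 2 ((R * Yᵀ) *ᵥ g))
  have hinner : inner ℝ (transposeInvEquiv R hR p) (transposeInvEquiv R hR s) = 0 := by
    have h1 : s.ofLp = Rᵀ *ᵥ (transposeInvEquiv R hR s).ofLp :=
      (congrArg WithLp.ofLp ((transposeInvEquiv R hR).symm_apply_apply s)).symm
    rw [h1] at hs
    rw [hTp, EuclideanSpace.inner_eq_star_dotProduct, star_trivial, Matrix.dotProduct_mulVec,
      ← Matrix.mulVec_transpose, Matrix.transpose_mul, Matrix.transpose_transpose,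
      ← Matrix.mulVec_mulVec, hs, zero_dotProduct]
  have hnorm : ‖transposeInvEquiv R hR p‖ ^ 2 = z ⬝ᵥ g := by
    rw [hTp, ← real_inner_self_eq_norm_sq, EuclideanSpace.inner_eq_star_dotProduct, star_trivial,
      Matrix.dotProduct_mulVec, ← Matrix.mulVec_transpose, hMg]
  have := rho_eq_exp_norm_sq R hR (p + s)
  rw [WithLp.ofLp_add] at this
  rw [this, map_add, norm_add_sq_real, hinner, hnorm, rho, ← Real.exp_add]
  congr 1
  ring

theorem summable_rho_intCast_add {m : ℕ} {R : Matrix (Fin m) (Fin m) ℝ} (hR : IsUnit R.det)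
    (c : Fin m → ℝ) : Summable fun v : Fin m → ℤ => rho R (intCast' v + c) := by
  have h := summable_gaussian
    ((EuclideanSpace.basisFun (Fin m) ℝ).toBasis.map (transposeInvEquiv R hR)) c
  refine h.congr fun v => ?_
  have h1 := rho_eq_exp_norm_sq R hR (WithLp.toLp 2 (intCast' v + c))
  rw [h1]
  congr 4
  rw [LinearEquiv.symm_apply_eq]
  ext i
  simp [intCast', add_comm]

theorem mulVec_intCast_add {n m : ℕ} (X : Matrix (Fin n) (Fin m) ℤ) (v : Fin m → ℤ)
    (c : Fin m → ℝ) : X.map (Int.cast : ℤ → ℝ) *ᵥ (intCast' v + c) =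
      intCast' (X *ᵥ v) + X.map (Int.cast : ℤ → ℝ) *ᵥ c := by
  rw [Matrix.mulVec_add]
  congr 1
  ext i
  simp [Matrix.mulVec, dotProduct, intCast']

theorem mulVec_intCast_add_eq_iff {n m : ℕ} (X : Matrix (Fin n) (Fin m) ℤ) (v : Fin m → ℤ)
    (c : Fin m → ℝ) (w : Fin n → ℤ) : X.map (Int.cast : ℤ → ℝ) *ᵥ (intCast' v + c) =
      intCast' w + X.map (Int.cast : ℤ → ℝ) *ᵥ c ↔ X *ᵥ v = w := by
  rw [mulVec_intCast_add, add_left_inj]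
  refine ⟨fun h => ?_, fun h => by rw [h]⟩
  ext i
  exact Int.cast_injective (α := ℝ) (congrFun h i)

theorem hasSum_tsum_ite_mulVec_eq {n m : ℕ} (X : Matrix (Fin n) (Fin m) ℤ)
    {f : (Fin m → ℤ) → ℝ} (hf : Summable f) :
    HasSum (fun w => ∑' v, if X *ᵥ v = w then f v else 0) (∑' v, f v) := by
  refine (hf.hasSum.tsum_fiberwise fun v => X *ᵥ v).congr_fun fun w => ?_
  rw [tsum_subtype]
  refine tsum_congr fun v => ?_
  simp [Set.indicator_apply]

/-- Sum over a fiber of `X`, by translation from the kernel. -/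
theorem tsum_ite_mulVec_eq {n m : ℕ} {κ : Type*} (X : Matrix (Fin n) (Fin m) ℤ)
    {A : κ → Fin m → ℤ} (hinj : Function.Injective A) (hA : ∀ l, X *ᵥ A l = 0)
    (hA' : ∀ v, X *ᵥ v = 0 → ∃ l, A l = v) (f : (Fin m → ℤ) → ℝ) (v₀ : Fin m → ℤ) :
    ∑' v, (if X *ᵥ v = X *ᵥ v₀ then f v else 0) = ∑' l, f (v₀ + A l) := by
  have h1 : Function.Injective fun l => v₀ + A l := (add_right_injective v₀).comp hinj
  rw [← h1.tsum_eq]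
  · refine tsum_congr fun l => ?_
    rw [if_pos]
    rw [Matrix.mulVec_add, hA, add_zero]
  · intro v hv
    have : X *ᵥ v = X *ᵥ v₀ := by
      by_contra h
      exact hv (if_neg h)
    obtain ⟨l, hl⟩ := hA' (v - v₀) (by rw [Matrix.mulVec_sub, this, sub_self])
    exact ⟨l, by simp [hl]⟩

/-- Lemma 3.3 of the paper. Let `X ∈ ℤ^{n×m}` (`m > n`) have full row rank,
let `A = {v ∈ ℤ^m : Xv = 0}`, `R ∈ ℝ^{m×m}` invertible, `c ∈ ℝ^m`, `0 < ε < 1/3`.  If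
`ρ_{1/σ_m(R)}(A* ∖ {0}) ≤ ε` (where `σ_m(R)` is the least singular value of `R`, characterized
by `σ_m(R)‖x‖ ≤ ‖Rx‖`, and `A*` is the dual lattice of `A` inside the span of `A`), then the
statistical distance between `E_{X,R,c}` and `D_{Xℤ^m + Xc, RXᵀ}` is at most `2ε`.  Both
distributions are supported inside `ℤ^n + Xc`, whose points are parametrized injectively by
`w ∈ ℤ^n`; the indicator `∃ v, Xv = w` cuts out the support `Xℤ^m + Xc`. -/
theorem statement1 {n m : ℕ} (hm : n < m)
    (X : Matrix (Fin n) (Fin m) ℤ)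
    (hrank : LinearIndependent ℝ (fun i : Fin n => fun j : Fin m => ((X i j : ℝ))))
    (R : Matrix (Fin m) (Fin m) ℝ) (hR : IsUnit R.det) (c : Fin m → ℝ)
    (ε : ℝ) (hε0 : 0 < ε) (hε : ε < 1 / 3)
    (σm : ℝ) (hσm0 : 0 < σm) (hσm : ∀ x : Fin m → ℝ, σm * enorm' x ≤ enorm' (R *ᵥ x))
    (Acast : Set (Fin m → ℝ))
    (hA : Acast = {y | ∃ v : Fin m → ℤ, X *ᵥ v = 0 ∧ y = intCast' v})
    (Adual : Set (Fin m → ℝ))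
    (hAdual : Adual = {y | y ∈ Submodule.span ℝ Acast ∧
        ∀ a ∈ Acast, ∃ k : ℤ, ∑ i, y i * a i = (k : ℝ)})
    (hsmooth : (∑' y : {y : Fin m → ℝ // y ∈ Adual ∧ y ≠ 0},
        Real.exp (-Real.pi * σm ^ 2 * ∑ i, (y.1 i) ^ 2)) ≤ ε) :
    (1 / 2) * (∑' w : Fin n → ℤ,
        |Edist (X.map (Int.cast : ℤ → ℝ)) R c (intCast' w + (X.map (Int.cast : ℤ → ℝ)) *ᵥ c)
          - (if ∃ v : Fin m → ℤ, X *ᵥ v = w then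
                rho (R * (X.map (Int.cast : ℤ → ℝ))ᵀ)
                  (intCast' w + (X.map (Int.cast : ℤ → ℝ)) *ᵥ c)
              else 0) /
            (∑' u : Fin n → ℤ,
              if ∃ v : Fin m → ℤ, X *ᵥ v = u then
                rho (R * (X.map (Int.cast : ℤ → ℝ))ᵀ)
                  (intCast' u + (X.map (Int.cast : ℤ → ℝ)) *ᵥ c)
              else 0)|)
      ≤ 2 * ε := by
  set Y := X.map (Int.cast : ℤ → ℝ) with hY
  obtain ⟨k, b, A, hA0, hA1, hbA⟩ := exists_basis_intKerSpan X
  let T := transposeInvEquiv R hR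
  let e := T.submoduleMap (intKerSpan X)
  have hM : IsUnit ((R * Yᵀ)ᵀ * (R * Yᵀ)).det := by
    refine isUnit_det_transpose_mul_self ?_
    have h1 : Function.Injective Yᵀ.mulVec := Matrix.mulVec_injective_iff.2 hrank
    have h2 : Function.Injective R.mulVec :=
      Matrix.mulVec_injective_of_isUnit ((Matrix.isUnit_iff_isUnit_det R).2 hR)
    intro x y h
    simp only [← Matrix.mulVec_mulVec] at h
    exact h1 (h2 h)
  have hAinj : Function.Injective A := by
    intro l l' h
    have h1 : b.equivFun.symm (fun i => (l i : ℝ)) = b.equivFun.symm fun i => (l' i : ℝ) :=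
      Subtype.ext (by rw [hbA, hbA, h])
    ext i
    exact_mod_cast congrFun (b.equivFun.symm.injective h1) i
  obtain ⟨K, hK, hKΘ⟩ := exists_abs_tsum_gaussian_sub_le (b.map e)
  have hε' : ∑' l : Fin k → ℤ, (if l = 0 then 0 else
      Real.exp (-Real.pi * ‖dualVec (b.map e) fun i => (l i : ℝ)‖ ^ 2)) ≤ ε := by
    refine le_trans ?_ hsmooth
    rw [← tsum_dualVec_intKerSpan X b A hA0 hA1 hbA Acast hA Adual hAdual
      fun t => Real.exp (-Real.pi * σm ^ 2 * t)]
    have hle (l : Fin k → ℤ) : (if l = 0 then 0 else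
        Real.exp (-Real.pi * ‖dualVec (b.map e) fun i => (l i : ℝ)‖ ^ 2)) ≤
        if l = 0 then 0 else
          Real.exp (-Real.pi * σm ^ 2 * ‖dualVec b fun i => (l i : ℝ)‖ ^ 2) := by
      split_ifs
      · exact le_rfl
      · have h1 := mul_norm_dualVec_le_norm_dualVec_map b e hσm0
          (fun y => mul_norm_transposeInvEquiv_le hR hσm0 hσm y) fun i => (l i : ℝ)
        rw [Real.exp_le_exp, neg_mul, neg_mul, neg_mul, neg_le_neg_iff, mul_assoc, ← mul_pow]
        gcongr
    have hs : Summable fun l : Fin k → ℤ => if l = 0 then 0 else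
        Real.exp (-Real.pi * σm ^ 2 * ‖dualVec b fun i => (l i : ℝ)‖ ^ 2) := by
      refine Summable.of_nonneg_of_le (fun l => by split_ifs <;> positivity) (fun l => ?_)
        (summable_exp_neg_norm_sq_dualVec b (show 0 < Real.pi * σm ^ 2 by positivity))
      split_ifs
      · positivity
      · rw [neg_mul]
    exact Summable.tsum_le_tsum hle
      (Summable.of_nonneg_of_le (fun l => by split_ifs <;> positivity) hle hs) hs
  have hfiber (v₀ : Fin m → ℤ) :
      |∑' l, rho R (intCast' (v₀ + A l) + c) -
        K * rho (R * Yᵀ) (intCast' (X *ᵥ v₀) + Y *ᵥ c)| ≤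
      K * ε * rho (R * Yᵀ) (intCast' (X *ᵥ v₀) + Y *ᵥ c) := by
    set z := intCast' (X *ᵥ v₀) + Y *ᵥ c with hz
    set p := Rᵀ *ᵥ ((R * Yᵀ) *ᵥ (((R * Yᵀ)ᵀ * (R * Yᵀ))⁻¹ *ᵥ z)) with hp
    have hYp : Y *ᵥ p = z := by
      have h1 : Y * Rᵀ = (R * Yᵀ)ᵀ := by simp
      rw [hp, Matrix.mulVec_mulVec, h1, Matrix.mulVec_mulVec, Matrix.mulVec_mulVec,
        Matrix.mul_nonsing_inv _ hM, Matrix.one_mulVec]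
    let t : intKerSpan X := ⟨WithLp.toLp 2 (intCast' v₀ + c - p), (mem_intKerSpan_iff X _).2 <| by
      rw [← hY, Matrix.mulVec_sub, hYp, hz, hY, mulVec_intCast_add, sub_self]⟩
    have hterm (l : Fin k → ℤ) : rho R (intCast' (v₀ + A l) + c) = rho (R * Yᵀ) z *
        Real.exp (-Real.pi *
          ‖(b.map e).equivFun.symm (b.equivFun t + fun i => (l i : ℝ))‖ ^ 2) := by
      set s : intKerSpan X := t + b.equivFun.symm (fun i => (l i : ℝ)) with hs
      have h1 : (b.map e).equivFun.symm (b.equivFun t + fun i => (l i : ℝ)) = e s := by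
        rw [LinearEquiv.symm_apply_eq]
        ext i
        simp [hs, -Module.Basis.equivFun_apply]
      have h2 := rho_add_of_mulVec_eq_zero hR hM z (mulVec_eq_zero_of_mem_intKerSpan X s.2)
      rw [h1]
      refine Eq.trans ?_ h2
      rw [← hp, hs, Submodule.coe_add, hbA]
      congr 1
      ext i
      simp [t, intCast']
      ring
    have hr : 0 ≤ rho (R * Yᵀ) z := (Real.exp_pos _).le
    simp_rw [hterm]
    rw [tsum_mul_left, mul_comm K, ← mul_sub, abs_mul, abs_of_nonneg hr, mul_comm _ (rho _ z)]
    exact mul_le_mul_of_nonneg_left ((hKΘ _).trans (mul_le_mul_of_nonneg_left hε' hK.le)) hr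
  simp_rw [Edist, hY, mulVec_intCast_add_eq_iff, ← hY]
  refine half_tsum_abs_div_sub_div_le hK hε0 hε (fun w => ?_) (fun w => ?_)
    (hasSum_tsum_ite_mulVec_eq X (summable_rho_intCast_add hR c)) ⟨0, ?_⟩
  · split_ifs
    · exact (Real.exp_pos _).le
    · exact le_rfl
  · split_ifs with h
    · obtain ⟨v₀, rfl⟩ := h
      rw [tsum_ite_mulVec_eq X hAinj hA0 hA1]
      exact hfiber v₀
    · rw [tsum_congr fun v => if_neg fun hv => h ⟨v, hv⟩]
      simp
  · rw [if_pos ⟨0, Matrix.mulVec_zero X⟩]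
    exact Real.exp_pos _
end

section
/- Let B and n be positive integers with B·n ≥ 16, and set ℓ = ⌊2n·log₂(Bn)⌋. For any vectors x_1, x_2, …, x_ℓ ∈ ℤ^n with ‖x_j‖_∞ ≤ B for all 1 ≤ j ≤ ℓ, there exist α_1,…,α_ℓ ∈ {−1, 0, 1}, not all zero, such that Σ_{j=1}^{ℓ} α_j x_j = 0. -/
open scoped BigOperators Matrix
attribute [local instance] Classical.propDecidable

/-- Siegel-type pigeonhole: if the box containing all subset sums of `N` integer vectors has fewer
points than there are subsets, some nontrivial `{-1, 0, 1}`-combination vanishes. -/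
lemma exists_signed_sum_eq_zero {B n N : ℕ} (x : Fin N → Fin n → ℤ)
    (hx : ∀ j i, |x j i| ≤ (B : ℤ)) (hcard : (B * N + 1) ^ n < 2 ^ N) :
    ∃ α : Fin N → ℤ, (∀ j, α j = -1 ∨ α j = 0 ∨ α j = 1) ∧ (∃ j, α j ≠ 0) ∧
      (∀ i : Fin n, ∑ j, α j * x j i = 0) := by
  let lo : Fin n → ℤ := fun i => ∑ j, min (x j i) 0
  let box : Finset (Fin n → ℤ) := Fintype.piFinset fun i => Finset.Icc (lo i) (lo i + B * N)
  let f : Finset (Fin N) → Fin n → ℤ := fun S i => ∑ j, if j ∈ S then x j i else 0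
  have hbox : box.card < (Finset.univ : Finset (Finset (Fin N))).card := by
    have h : ∀ i, (Finset.Icc (lo i) (lo i + B * N)).card = B * N + 1 := by
      intro i
      rw [Int.card_Icc]
      have : (lo i + B * N + 1 - lo i : ℤ) = ((B * N + 1 : ℕ) : ℤ) := by push_cast; ring
      rw [this, Int.toNat_natCast]
    simpa [box, Fintype.card_piFinset, h] using hcard
  have hf : ∀ S ∈ (Finset.univ : Finset (Finset (Fin N))), f S ∈ box := by
    intro S _
    refine Fintype.mem_piFinset.2 fun i => Finset.mem_Icc.2 ⟨?_, ?_⟩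
    · refine Finset.sum_le_sum fun j _ => ?_
      split_ifs
      · exact min_le_left _ _
      · exact min_le_right _ _
    · have h : lo i + B * N = ∑ j : Fin N, (min (x j i) 0 + (B : ℤ)) := by
        simp [lo, Finset.sum_add_distrib, mul_comm]
      rw [h]
      refine Finset.sum_le_sum fun j _ => ?_
      have hj := abs_le.1 (hx j i)
      split_ifs <;> omega
  obtain ⟨S, -, T, -, hST, hfST⟩ := Finset.exists_ne_map_eq_of_card_lt_of_maps_to hbox hf
  refine ⟨fun j => (if j ∈ S then 1 else 0) - (if j ∈ T then 1 else 0), ?_, ?_, ?_⟩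
  · intro j
    by_cases hS : j ∈ S <;> by_cases hT : j ∈ T <;> simp [hS, hT]
  · by_contra! h
    refine hST (Finset.ext fun j => ?_)
    have hj := h j
    by_cases hS : j ∈ S <;> by_cases hT : j ∈ T <;> simp_all
  · intro i
    have h : f S i = f T i := congrFun hfST i
    simpa [f, sub_mul, Finset.sum_sub_distrib, sub_eq_zero] using h

lemma logb_two_le_of_seventeen_le {M : ℝ} (hM : 17 ≤ M) :
    2 * (2 * M * Real.logb 2 M + 1) ≤ M ^ 2 := by
  have hlog2 : (2 / 3 : ℝ) ≤ Real.log 2 := by linarith [Real.log_two_gt_d9]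
  have hlog : Real.log M ≤ 4 * Real.log 2 + (M / 16 - 1) := by
    have h := Real.log_le_sub_one_of_pos (show 0 < M / 16 by linarith)
    rw [Real.log_div (by linarith) (by norm_num), show (16 : ℝ) = 2 ^ 4 by norm_num,
      Real.log_pow] at h
    norm_num at h ⊢
    linarith
  have hL : Real.logb 2 M ≤ 4 + 3 / 2 * (M / 16 - 1) := by
    rw [Real.logb, div_le_iff₀ (by linarith)]
    nlinarith
  nlinarith [mul_le_mul_of_nonneg_left hL (show 0 ≤ M by linarith)]

/-- The counting inequality behind the pigeonhole argument. -/
lemma box_card_lt_two_pow {B n : ℕ} (hn : 1 ≤ n) (hBn : 16 ≤ B * n) :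
    (B * ⌊2 * (n : ℝ) * Real.logb 2 ((B : ℝ) * n)⌋₊ + 1) ^ n <
      2 ^ ⌊2 * (n : ℝ) * Real.logb 2 ((B : ℝ) * n)⌋₊ := by
  rcases hBn.eq_or_lt with h16 | h17
  · have hlog : Real.logb 2 ((B : ℝ) * n) = 4 := by
      rw [show (B : ℝ) * n = 2 ^ (4 : ℝ) by norm_num; exact_mod_cast h16.symm]
      exact Real.logb_rpow (by norm_num) (by norm_num)
    have hfloor : ⌊2 * (n : ℝ) * Real.logb 2 ((B : ℝ) * n)⌋₊ = 8 * n := by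
      rw [hlog, show 2 * (n : ℝ) * 4 = ((8 * n : ℕ) : ℝ) by push_cast; ring, Nat.floor_natCast]
    rw [hfloor, pow_mul, show B * (8 * n) + 1 = 129 by linarith]
    exact Nat.pow_lt_pow_left (by norm_num) (by omega)
  · have hM : (17 : ℝ) ≤ (B : ℝ) * n := by exact_mod_cast h17
    set M : ℝ := (B : ℝ) * n with hMdef
    have hkey := logb_two_le_of_seventeen_le hM
    have hL : 0 ≤ Real.logb 2 M := Real.logb_nonneg (by norm_num) (by linarith)
    set N := ⌊2 * (n : ℝ) * Real.logb 2 M⌋₊ with hN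
    have hNle : (N : ℝ) ≤ 2 * n * Real.logb 2 M := Nat.floor_le (by positivity)
    have hNlt : 2 * n * Real.logb 2 M < (N : ℝ) + 1 := Nat.lt_floor_add_one _
    have hbase : (B : ℝ) * N + 1 ≤ 2 * M * Real.logb 2 M + 1 := by
      have := mul_le_mul_of_nonneg_left hNle (Nat.cast_nonneg (α := ℝ) B)
      rw [hMdef] at this ⊢
      linarith
    have hpow : (M ^ 2) ^ n < 2 * (2 : ℝ) ^ N := by
      have h : (M ^ 2) ^ n = (2 : ℝ) ^ (2 * n * Real.logb 2 M) := by
        rw [mul_comm, Real.rpow_mul (by norm_num),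
          Real.rpow_logb (by norm_num) (by norm_num) (by linarith), ← pow_mul,
          ← Real.rpow_natCast]
        push_cast
        rfl
      rw [h, ← pow_succ', ← Real.rpow_natCast]
      exact Real.rpow_lt_rpow_of_exponent_lt (by norm_num) (by push_cast; exact hNlt)
    have hmain : 2 * ((B : ℝ) * N + 1) ^ n < 2 * (2 : ℝ) ^ N := by
      calc 2 * ((B : ℝ) * N + 1) ^ n ≤ 2 ^ n * ((B : ℝ) * N + 1) ^ n := by
            gcongr
            exact le_self_pow₀ (by norm_num) (by omega)
        _ = (2 * ((B : ℝ) * N + 1)) ^ n := (mul_pow _ _ _).symm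
        _ ≤ (M ^ 2) ^ n := by
            gcongr
            linarith
        _ < _ := hpow
    exact_mod_cast lt_of_mul_lt_mul_left hmain (by norm_num)

/-- Claim 4.1, pigeon-hole. Let `B, n ≥ 1` with `Bn ≥ 16` and set
`ℓ = ⌊2n·log₂(Bn)⌋`.  For any `x_1, …, x_ℓ ∈ ℤ^n` with `‖x_j‖_∞ ≤ B` there exist
`α_1, …, α_ℓ ∈ {−1,0,1}`, not all zero, with `∑_j α_j x_j = 0`. -/
theorem statement4 (B n : ℕ) (hB : 1 ≤ B) (hn : 1 ≤ n) (hBn : 16 ≤ B * n)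
    (x : Fin (⌊2 * (n : ℝ) * Real.logb 2 ((B : ℝ) * n)⌋₊) → Fin n → ℤ)
    (hx : ∀ j i, |x j i| ≤ (B : ℤ)) :
    ∃ α : Fin (⌊2 * (n : ℝ) * Real.logb 2 ((B : ℝ) * n)⌋₊) → ℤ,
      (∀ j, α j = -1 ∨ α j = 0 ∨ α j = 1) ∧
      (∃ j, α j ≠ 0) ∧
      (∀ i : Fin n, ∑ j, α j * x j i = 0) :=
  exists_signed_sum_eq_zero x hx (box_card_lt_two_pow hn hBn)
end
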